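/- Let n be a natural number. No Πₙ-definable extension of Robinson arithmetic Q that is consistent together with the set Πₙ-Th(ℕ) of all true Πₙ-sentences is Π_{n+1}-deciding: if T ⊇ Q has its set of (Gödel numbers of) axioms definable in ℕ by a Πₙ-formula and T + Πₙ-Th(ℕ) is consistent, then there exists a Π_{n+1}-sentence γ (true in ℕ) with T ⊬ γ and T ⊬ ¬γ. -/

import Mathlib

/-!
Formalization of results from "Gödel–Rosser's Incompleteness Theorems for
non-RE Theories" (Salehi & Seraji).

We work in the first-order language of arithmetic `{0, S, +, ×, ≤}` with the
standard model `ℕ`.  Provability `T ⊢ φ` is rendered as the semantic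
consequence `T ⊨ᵇ φ` of Mathlib's model theory library, which by the Gödel
completeness theorem coincides with provability in first-order logic.
-/

open FirstOrder Language BoundedFormula

namespace GRNonRE

/-- Function symbols of arithmetic: `0`, `S`, `+`, `×`. -/
inductive ArithFunc : ℕ → Type
  | zero : ArithFunc 0
  | succ : ArithFunc 1
  | add  : ArithFunc 2
  | mul  : ArithFunc 2

/-- The relation symbol `≤`. -/
inductive ArithRel : ℕ → Type
  | le : ArithRel 2

/-- The first-order language of arithmetic `{0, S, +, ×, ≤}`. -/
def LA : FirstOrder.Language := ⟨ArithFunc, ArithRel⟩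

/-- The standard model `ℕ`. -/
instance : LA.Structure ℕ where
  funMap {_} f := match f with
    | ArithFunc.zero => fun _ => 0
    | ArithFunc.succ => fun v => v 0 + 1
    | ArithFunc.add  => fun v => v 0 + v 1
    | ArithFunc.mul  => fun v => v 0 * v 1
  RelMap {_} r := match r with
    | ArithRel.le => fun v => v 0 ≤ v 1

def zeroT {α : Type} : LA.Term α := Term.func ArithFunc.zero ![]
def succT {α : Type} (t : LA.Term α) : LA.Term α := Term.func ArithFunc.succ ![t]
def addT {α : Type} (t s : LA.Term α) : LA.Term α := Term.func ArithFunc.add ![t, s]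
def mulT {α : Type} (t s : LA.Term α) : LA.Term α := Term.func ArithFunc.mul ![t, s]

/-- The atomic formula `t ≤ s`. -/
def leF {α : Type} {n : ℕ} (t s : LA.Term (α ⊕ Fin n)) : LA.BoundedFormula α n :=
  BoundedFormula.rel ArithRel.le ![t, s]

/-- The numeral `m̄ = S (S ⋯ (S 0))` representing `m : ℕ`. -/
def numeral : ℕ → LA.Term Empty
  | 0 => zeroT
  | n + 1 => succT (numeral n)

instance : Encodable (Σ n, LA.Functions n) :=
  ⟨fun f => match f with
    | ⟨_, ArithFunc.zero⟩ => 0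
    | ⟨_, ArithFunc.succ⟩ => 1
    | ⟨_, ArithFunc.add⟩ => 2
    | ⟨_, ArithFunc.mul⟩ => 3,
   fun n => match n with
    | 0 => some ⟨0, ArithFunc.zero⟩
    | 1 => some ⟨1, ArithFunc.succ⟩
    | 2 => some ⟨2, ArithFunc.add⟩
    | 3 => some ⟨2, ArithFunc.mul⟩
    | _ => none,
   by rintro ⟨n, f⟩; cases f <;> rfl⟩

instance : Encodable (Σ n, LA.Relations n) :=
  ⟨fun _ => 0,
   fun n => match n with
    | 0 => some ⟨2, ArithRel.le⟩
    | _ => none,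
   by rintro ⟨n, r⟩; cases r; rfl⟩

/-- A standard Gödel numbering of formulas, obtained from Mathlib's structural
encoding of bounded formulas as lists of symbols. -/
def godel {k : ℕ} (φ : LA.BoundedFormula Empty k) : ℕ :=
  Encodable.encode φ.listEncode

/-- Lift a term in context `k` to context `k + 1`. -/
def liftT {k : ℕ} (t : LA.Term (Empty ⊕ Fin k)) : LA.Term (Empty ⊕ Fin (k + 1)) :=
  t.relabel (Sum.map id Fin.castSucc)

/-- The class `Σ₀ = Π₀ = Δ₀` of bounded formulas: built from atomic formulas by
Boolean connectives (`⊥` and `⟹`, from which `∼`, `⊓`, `⊔` are definable) and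
bounded universal quantification `∀ x ≤ t, φ` (bounded existential
quantification `∃ x ≤ t, φ` is expressible as `∼ ∀ x ≤ t, ∼φ`). -/
inductive Delta0 : ∀ {k : ℕ}, LA.BoundedFormula Empty k → Prop
  | falsum {k : ℕ} : Delta0 (⊥ : LA.BoundedFormula Empty k)
  | equal {k : ℕ} (t₁ t₂ : LA.Term (Empty ⊕ Fin k)) : Delta0 (t₁ =' t₂)
  | le {k : ℕ} (t₁ t₂ : LA.Term (Empty ⊕ Fin k)) : Delta0 (leF t₁ t₂)
  | imp {k : ℕ} {φ ψ : LA.BoundedFormula Empty k} :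
      Delta0 φ → Delta0 ψ → Delta0 (φ ⟹ ψ)
  | bdall {k : ℕ} (t : LA.Term (Empty ⊕ Fin k)) {φ : LA.BoundedFormula Empty (k + 1)} :
      Delta0 φ → Delta0 ((leF (&(Fin.last k)) (liftT t) ⟹ φ).all)

mutual
  /-- The classes `Σₙ` of the arithmetical hierarchy: `Σ₀` is the class of
  bounded formulas, and `Σ_{n+1}` contains `Πₙ` and is closed under `⊓`, `⊔`,
  existential quantification and bounded universal quantification. -/
  inductive IsSigma : ℕ → ∀ {k : ℕ}, LA.BoundedFormula Empty k → Prop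
    | ofDelta0 {k : ℕ} {φ : LA.BoundedFormula Empty k} : Delta0 φ → IsSigma 0 φ
    | ofPi {n k : ℕ} {φ : LA.BoundedFormula Empty k} :
        IsPi n φ → IsSigma (n + 1) φ
    | ex {n k : ℕ} {φ : LA.BoundedFormula Empty (k + 1)} :
        IsSigma (n + 1) φ → IsSigma (n + 1) φ.ex
    | inf {n k : ℕ} {φ ψ : LA.BoundedFormula Empty k} :
        IsSigma (n + 1) φ → IsSigma (n + 1) ψ → IsSigma (n + 1) (φ ⊓ ψ)
    | sup {n k : ℕ} {φ ψ : LA.BoundedFormula Empty k} :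
        IsSigma (n + 1) φ → IsSigma (n + 1) ψ → IsSigma (n + 1) (φ ⊔ ψ)
    | bdall {n k : ℕ} (t : LA.Term (Empty ⊕ Fin k))
        {φ : LA.BoundedFormula Empty (k + 1)} :
        IsSigma (n + 1) φ → IsSigma (n + 1) ((leF (&(Fin.last k)) (liftT t) ⟹ φ).all)

  /-- The classes `Πₙ` of the arithmetical hierarchy: `Π₀` is the class of
  bounded formulas, and `Π_{n+1}` contains `Σₙ` and is closed under `⊓`, `⊔`,
  universal quantification and bounded existential quantification. -/
  inductive IsPi : ℕ → ∀ {k : ℕ}, LA.BoundedFormula Empty k → Prop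
    | ofDelta0 {k : ℕ} {φ : LA.BoundedFormula Empty k} : Delta0 φ → IsPi 0 φ
    | ofSigma {n k : ℕ} {φ : LA.BoundedFormula Empty k} :
        IsSigma n φ → IsPi (n + 1) φ
    | all {n k : ℕ} {φ : LA.BoundedFormula Empty (k + 1)} :
        IsPi (n + 1) φ → IsPi (n + 1) φ.all
    | inf {n k : ℕ} {φ ψ : LA.BoundedFormula Empty k} :
        IsPi (n + 1) φ → IsPi (n + 1) ψ → IsPi (n + 1) (φ ⊓ ψ)
    | sup {n k : ℕ} {φ ψ : LA.BoundedFormula Empty k} :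
        IsPi (n + 1) φ → IsPi (n + 1) ψ → IsPi (n + 1) (φ ⊔ ψ)
    | bdex {n k : ℕ} (t : LA.Term (Empty ⊕ Fin k))
        {φ : LA.BoundedFormula Empty (k + 1)} :
        IsPi (n + 1) φ → IsPi (n + 1) ((leF (&(Fin.last k)) (liftT t) ⊓ φ).ex)
end

/-- `T ⊢ φ`: by the Gödel completeness theorem, provability of the sentence `φ`
from the theory `T` coincides with the semantic consequence relation. -/
def Proves (T : LA.Theory) (φ : LA.Sentence) : Prop := T ⊨ᵇ φ

/-- Consistency of a theory. -/
def Consistent (T : LA.Theory) : Prop := ¬ Proves T ⊥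

/-- `ψ(m̄)`: the result of substituting the numeral `m̄` for the free variable
of a formula `ψ(x)` with one free variable. -/
def subst1 (ψ : LA.BoundedFormula Empty 1) (m : ℕ) : LA.Sentence :=
  ψ.toFormula.subst fun _ => numeral m

/-- `n`-consistency: there is no formula `ψ(x) ∈ Π_{n-1}` such that `T ⊢ ¬ψ(m̄)`
for every numeral `m̄` (`m ∈ ℕ`) and yet `T ⊢ ∃x ψ(x)`.
(`0`-consistency is ordinary consistency.) -/
def NCon : ℕ → LA.Theory → Prop
  | 0, T => Consistent T
  | n + 1, T => ¬ ∃ ψ : LA.BoundedFormula Empty 1, IsPi n ψ ∧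
      (∀ m : ℕ, Proves T (∼(subst1 ψ m))) ∧ Proves T ψ.ex

/-- The axioms of Robinson arithmetic `Q`:
`Sx ≠ 0`, `Sx = Sy → x = y`, `x ≠ 0 → ∃y x = Sy`, `x + 0 = x`,
`x + Sy = S(x + y)`, `x·0 = 0`, `x·Sy = x·y + x`, `x ≤ y ↔ ∃z z + x = y`. -/
def QTheory : LA.Theory :=
  { ∀' ∼(succT (&0) =' zeroT),
    ∀' ∀' ((succT (&0) =' succT (&1)) ⟹ (&0 =' &1)),
    ∀' (∼(&0 =' zeroT) ⟹ ∃' (&0 =' succT (&1))),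
    ∀' (addT (&0) zeroT =' &0),
    ∀' ∀' (addT (&0) (succT (&1)) =' succT (addT (&0) (&1))),
    ∀' (mulT (&0) zeroT =' zeroT),
    ∀' ∀' (mulT (&0) (succT (&1)) =' addT (mulT (&0) (&1)) (&0)),
    ((leF (&0) (&1) ⇔ ∃' (addT (&2) (&0) =' (&1)) : LA.BoundedFormula Empty 2)).alls }

/-- `T` is an extension of Robinson arithmetic `Q` (i.e. `T` proves `Q`). -/
def ExtendsQ (T : LA.Theory) : Prop := ∀ φ ∈ QTheory, Proves T φ

/-- `Πₙ-Th(ℕ)`: the set of `Πₙ`-sentences true in the standard model. -/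
def PiTh (n : ℕ) : LA.Theory := {φ | IsPi n φ ∧ ℕ ⊨ φ}

/-- Soundness: every theorem of `T` is true in `ℕ`. -/
def Sound (T : LA.Theory) : Prop := ∀ φ : LA.Sentence, Proves T φ → ℕ ⊨ φ

/-- `Σₙ`-soundness: every `Σₙ`-sentence provable in `T` is true in `ℕ`. -/
def SigmaSound (n : ℕ) (T : LA.Theory) : Prop :=
  ∀ φ : LA.Sentence, IsSigma n φ → Proves T φ → ℕ ⊨ φ

/-- A formula `Ψ(x)` with one free variable defines the set `A ⊆ ℕ` in `ℕ`. -/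
def Defines (Ψ : LA.BoundedFormula Empty 1) (A : Set ℕ) : Prop :=
  ∀ m : ℕ, m ∈ A ↔ Ψ.Realize (fun e => Empty.elim e) ![m]

/-- `A ⊆ ℕ` is definable in `ℕ` by a `Σₙ`-formula. -/
def SigmaDefinable (n : ℕ) (A : Set ℕ) : Prop := ∃ Ψ, IsSigma n Ψ ∧ Defines Ψ A

/-- `A ⊆ ℕ` is definable in `ℕ` by a `Πₙ`-formula. -/
def PiDefinable (n : ℕ) (A : Set ℕ) : Prop := ∃ Ψ, IsPi n Ψ ∧ Defines Ψ A

/-- The set of Gödel numbers of the axioms of `T`. -/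
def axiomCodes (T : LA.Theory) : Set ℕ := {m | ∃ φ ∈ T, godel φ = m}

/-- The set of Gödel numbers of the theorems of `T` (its deductive closure). -/
def theoremCodes (T : LA.Theory) : Set ℕ := {m | ∃ φ, Proves T φ ∧ godel φ = m}

/-- Simultaneous induction on the classes `Σₙ` and `Πₙ`. -/
theorem hierarchy_induction {S P : ∀ (_ : ℕ) {k : ℕ}, LA.BoundedFormula Empty k → Prop}
    (sDelta : ∀ {k} {φ : LA.BoundedFormula Empty k}, Delta0 φ → S 0 φ)
    (sPi : ∀ {n k} {φ : LA.BoundedFormula Empty k}, IsPi n φ → P n φ → S (n + 1) φ)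
    (sEx : ∀ {n k} {φ : LA.BoundedFormula Empty (k + 1)}, S (n + 1) φ → S (n + 1) φ.ex)
    (sInf : ∀ {n k} {φ ψ : LA.BoundedFormula Empty k},
      S (n + 1) φ → S (n + 1) ψ → S (n + 1) (φ ⊓ ψ))
    (sSup : ∀ {n k} {φ ψ : LA.BoundedFormula Empty k},
      S (n + 1) φ → S (n + 1) ψ → S (n + 1) (φ ⊔ ψ))
    (sAll : ∀ {n k} (t : LA.Term (Empty ⊕ Fin k)) {φ : LA.BoundedFormula Empty (k + 1)},
      S (n + 1) φ → S (n + 1) (leF (&(Fin.last k)) (liftT t) ⟹ φ).all)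
    (pDelta : ∀ {k} {φ : LA.BoundedFormula Empty k}, Delta0 φ → P 0 φ)
    (pSigma : ∀ {n k} {φ : LA.BoundedFormula Empty k}, IsSigma n φ → S n φ → P (n + 1) φ)
    (pAll : ∀ {n k} {φ : LA.BoundedFormula Empty (k + 1)}, P (n + 1) φ → P (n + 1) φ.all)
    (pInf : ∀ {n k} {φ ψ : LA.BoundedFormula Empty k},
      P (n + 1) φ → P (n + 1) ψ → P (n + 1) (φ ⊓ ψ))
    (pSup : ∀ {n k} {φ ψ : LA.BoundedFormula Empty k},
      P (n + 1) φ → P (n + 1) ψ → P (n + 1) (φ ⊔ ψ))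
    (pEx : ∀ {n k} (t : LA.Term (Empty ⊕ Fin k)) {φ : LA.BoundedFormula Empty (k + 1)},
      P (n + 1) φ → P (n + 1) (leF (&(Fin.last k)) (liftT t) ⊓ φ).ex) :
    (∀ {n k} {φ : LA.BoundedFormula Empty k}, IsSigma n φ → S n φ) ∧
      ∀ {n k} {φ : LA.BoundedFormula Empty k}, IsPi n φ → P n φ :=
  ⟨fun h => IsSigma.rec (motive_1 := fun n _ φ _ => S n φ) (motive_2 := fun n _ φ _ => P n φ)
      sDelta sPi (fun _ => sEx) (fun _ _ => sInf) (fun _ _ => sSup) (fun t _ _ => sAll t)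
      pDelta pSigma (fun _ => pAll) (fun _ _ => pInf) (fun _ _ => pSup) (fun t _ _ => pEx t) h,
    fun h => IsPi.rec (motive_1 := fun n _ φ _ => S n φ) (motive_2 := fun n _ φ _ => P n φ)
      sDelta sPi (fun _ => sEx) (fun _ _ => sInf) (fun _ _ => sSup) (fun t _ _ => sAll t)
      pDelta pSigma (fun _ => pAll) (fun _ _ => pInf) (fun _ _ => pSup) (fun t _ _ => pEx t) h⟩

theorem isSigma_succ_and_isPi_succ :
    (∀ {n k} {φ : LA.BoundedFormula Empty k}, IsSigma n φ → IsSigma (n + 1) φ) ∧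
      ∀ {n k} {φ : LA.BoundedFormula Empty k}, IsPi n φ → IsPi (n + 1) φ :=
  hierarchy_induction (S := fun n _ φ => IsSigma (n + 1) φ) (P := fun n _ φ => IsPi (n + 1) φ)
    (fun h => .ofPi (.ofDelta0 h)) (fun _ h => .ofPi h) .ex .inf .sup .bdall
    (fun h => .ofSigma (.ofDelta0 h)) (fun _ h => .ofSigma h) .all .inf .sup .bdex

theorem IsSigma.of_one {n k : ℕ} {φ : LA.BoundedFormula Empty k} (h : IsSigma 1 φ) :
    IsSigma (n + 1) φ := by
  induction n with
  | zero => exact h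
  | succ n ih => exact isSigma_succ_and_isPi_succ.1 ih

/-- The realization of a formula at an environment given on its bound variables only. -/
abbrev Sat {M : Type} [LA.Structure M] {k : ℕ} (φ : LA.BoundedFormula Empty k) (v : Fin k → M) :
    Prop :=
  φ.Realize (default : Empty → M) v

/-- The value of a term without free variables outside the context. -/
abbrev tval {M : Type} [LA.Structure M] {k : ℕ} (t : LA.Term (Empty ⊕ Fin k)) (v : Fin k → M) :
    M :=
  t.realize (Sum.elim (default : Empty → M) v)

/-- The interpretation of `≤` in an `LA`-structure. -/
abbrev leM {M : Type} [LA.Structure M] (a b : M) : Prop :=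
  Structure.RelMap (L := LA) (ArithRel.le : LA.Relations 2) ![a, b]

section Realize

variable {M : Type} [LA.Structure M] {k : ℕ}

theorem sat_leF (t s : LA.Term (Empty ⊕ Fin k)) (v : Fin k → M) :
    Sat (leF t s) v ↔ leM (tval t v) (tval s v) := by
  have h : (fun i => tval (![t, s] i) v) = ![tval t v, tval s v] := by
    funext i; fin_cases i <;> rfl
  unfold leM
  rw [← h]
  exact Iff.rfl

theorem tval_var (i : Fin k) (v : Fin k → M) : tval (&i : LA.Term (Empty ⊕ Fin k)) v = v i := rfl

theorem tval_liftT (t : LA.Term (Empty ⊕ Fin k)) (v : Fin k → M) (a : M) :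
    tval (liftT t) (Fin.snoc v a : Fin (k + 1) → M) = tval t v := by
  unfold tval liftT
  rw [Term.realize_relabel]
  congr 1
  funext x
  rcases x with x | x
  · exact x.elim
  · simp

theorem sat_le_last (t : LA.Term (Empty ⊕ Fin k)) (v : Fin k → M) (a : M) :
    Sat (leF (&(Fin.last k)) (liftT t)) (Fin.snoc v a : Fin (k + 1) → M) ↔ leM a (tval t v) := by
  rw [sat_leF, tval_liftT, tval_var, Fin.snoc_last]

theorem sat_bdall (t : LA.Term (Empty ⊕ Fin k)) (φ : LA.BoundedFormula Empty (k + 1))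
    (v : Fin k → M) :
    Sat (leF (&(Fin.last k)) (liftT t) ⟹ φ).all v ↔
      ∀ a, leM a (tval t v) → Sat φ (Fin.snoc v a : Fin (k + 1) → M) := by
  simp only [Sat, realize_all, realize_imp, ← sat_le_last]

theorem sat_bdex (t : LA.Term (Empty ⊕ Fin k)) (φ : LA.BoundedFormula Empty (k + 1))
    (v : Fin k → M) :
    Sat (leF (&(Fin.last k)) (liftT t) ⊓ φ).ex v ↔
      ∃ a, leM a (tval t v) ∧ Sat φ (Fin.snoc v a : Fin (k + 1) → M) := by
  simp only [Sat, realize_ex, realize_inf, ← sat_le_last]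

end Realize

/-- The substitution of terms in contexts, extended below a quantifier. -/
def liftSubst {k m : ℕ} (f : Fin k → LA.Term (Empty ⊕ Fin m)) :
    Fin (k + 1) → LA.Term (Empty ⊕ Fin (m + 1)) :=
  Fin.snoc (α := fun _ => LA.Term (Empty ⊕ Fin (m + 1))) (fun i => liftT (f i)) (&(Fin.last m))

theorem tval_liftSubst {M : Type} [LA.Structure M] {k m : ℕ}
    (f : Fin k → LA.Term (Empty ⊕ Fin m)) (v : Fin m → M) (a : M) :
    (fun i => tval (liftSubst f i) (Fin.snoc v a : Fin (m + 1) → M)) =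
      (Fin.snoc (fun i => tval (f i) v) a : Fin (k + 1) → M) := by
  funext i
  refine Fin.lastCases ?_ (fun i => ?_) i
  · simp [liftSubst]
  · simp [liftSubst, tval_liftT]

/-- `t[f]`. -/
def substT {k m : ℕ} (f : Fin k → LA.Term (Empty ⊕ Fin m)) (t : LA.Term (Empty ⊕ Fin k)) :
    LA.Term (Empty ⊕ Fin m) :=
  t.subst (Sum.elim (fun e => e.elim) f)

theorem tval_substT {M : Type} [LA.Structure M] {k m : ℕ} (f : Fin k → LA.Term (Empty ⊕ Fin m))
    (t : LA.Term (Empty ⊕ Fin k)) (v : Fin m → M) :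
    tval (substT f t) v = tval t (fun i => tval (f i) v) := by
  unfold tval substT
  rw [Term.realize_subst]
  congr 1
  funext x
  rcases x with x | x
  · exact x.elim
  · rfl

/-- `φ` has an instance under the substitution `f` satisfying `C`. -/
def SubstClosed (C : ∀ {k : ℕ}, LA.BoundedFormula Empty k → Prop) {k : ℕ}
    (φ : LA.BoundedFormula Empty k) : Prop :=
  ∀ (m : ℕ) (f : Fin k → LA.Term (Empty ⊕ Fin m)), ∃ ψ : LA.BoundedFormula Empty m, C ψ ∧
    ∀ (M : Type) [LA.Structure M] (v : Fin m → M), Sat ψ v ↔ Sat φ (fun i => tval (f i) v)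

section SubstClosed

variable {C : ∀ {k : ℕ}, LA.BoundedFormula Empty k → Prop} {k : ℕ}

theorem SubstClosed.inf (hC : ∀ {k} {φ ψ : LA.BoundedFormula Empty k}, C φ → C ψ → C (φ ⊓ ψ))
    {φ ψ : LA.BoundedFormula Empty k} (hφ : SubstClosed C φ) (hψ : SubstClosed C ψ) :
    SubstClosed C (φ ⊓ ψ) := by
  intro m f
  obtain ⟨φ', h1, h2⟩ := hφ m f
  obtain ⟨ψ', h3, h4⟩ := hψ m f
  refine ⟨φ' ⊓ ψ', hC h1 h3, fun M _ v => ?_⟩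
  simp only [Sat, realize_inf] at *
  rw [h2 M v, h4 M v]

theorem SubstClosed.sup (hC : ∀ {k} {φ ψ : LA.BoundedFormula Empty k}, C φ → C ψ → C (φ ⊔ ψ))
    {φ ψ : LA.BoundedFormula Empty k} (hφ : SubstClosed C φ) (hψ : SubstClosed C ψ) :
    SubstClosed C (φ ⊔ ψ) := by
  intro m f
  obtain ⟨φ', h1, h2⟩ := hφ m f
  obtain ⟨ψ', h3, h4⟩ := hψ m f
  refine ⟨φ' ⊔ ψ', hC h1 h3, fun M _ v => ?_⟩
  simp only [Sat, realize_sup] at *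
  rw [h2 M v, h4 M v]

theorem SubstClosed.ex (hC : ∀ {k} {φ : LA.BoundedFormula Empty (k + 1)}, C φ → C φ.ex)
    {φ : LA.BoundedFormula Empty (k + 1)} (hφ : SubstClosed C φ) : SubstClosed C φ.ex := by
  intro m f
  obtain ⟨φ', h1, h2⟩ := hφ _ (liftSubst f)
  refine ⟨φ'.ex, hC h1, fun M _ v => ?_⟩
  simp only [Sat, realize_ex] at *
  refine exists_congr fun a => ?_
  rw [h2 M, tval_liftSubst]

theorem SubstClosed.all (hC : ∀ {k} {φ : LA.BoundedFormula Empty (k + 1)}, C φ → C φ.all)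
    {φ : LA.BoundedFormula Empty (k + 1)} (hφ : SubstClosed C φ) : SubstClosed C φ.all := by
  intro m f
  obtain ⟨φ', h1, h2⟩ := hφ _ (liftSubst f)
  refine ⟨φ'.all, hC h1, fun M _ v => ?_⟩
  simp only [Sat, realize_all] at *
  refine forall_congr' fun a => ?_
  rw [h2 M, tval_liftSubst]

theorem SubstClosed.bdall (hC : ∀ {k} (t : LA.Term (Empty ⊕ Fin k))
    {φ : LA.BoundedFormula Empty (k + 1)}, C φ → C (leF (&(Fin.last k)) (liftT t) ⟹ φ).all)
    (t : LA.Term (Empty ⊕ Fin k)) {φ : LA.BoundedFormula Empty (k + 1)} (hφ : SubstClosed C φ) :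
    SubstClosed C (leF (&(Fin.last k)) (liftT t) ⟹ φ).all := by
  intro m f
  obtain ⟨φ', h1, h2⟩ := hφ _ (liftSubst f)
  refine ⟨_, hC (substT f t) h1, fun M _ v => ?_⟩
  rw [sat_bdall, sat_bdall]
  refine forall_congr' fun a => ?_
  rw [h2 M, tval_liftSubst, tval_substT]

theorem SubstClosed.bdex (hC : ∀ {k} (t : LA.Term (Empty ⊕ Fin k))
    {φ : LA.BoundedFormula Empty (k + 1)}, C φ → C (leF (&(Fin.last k)) (liftT t) ⊓ φ).ex)
    (t : LA.Term (Empty ⊕ Fin k)) {φ : LA.BoundedFormula Empty (k + 1)} (hφ : SubstClosed C φ) :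
    SubstClosed C (leF (&(Fin.last k)) (liftT t) ⊓ φ).ex := by
  intro m f
  obtain ⟨φ', h1, h2⟩ := hφ _ (liftSubst f)
  refine ⟨_, hC (substT f t) h1, fun M _ v => ?_⟩
  rw [sat_bdex, sat_bdex]
  refine exists_congr fun a => ?_
  rw [h2 M, tval_liftSubst, tval_substT]

theorem SubstClosed.mono {D : ∀ {k : ℕ}, LA.BoundedFormula Empty k → Prop}
    (hCD : ∀ {k} {φ : LA.BoundedFormula Empty k}, C φ → D φ) {φ : LA.BoundedFormula Empty k}
    (hφ : SubstClosed C φ) : SubstClosed D φ := fun m f =>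
  let ⟨ψ, h1, h2⟩ := hφ m f
  ⟨ψ, hCD h1, h2⟩

end SubstClosed

theorem Delta0.substClosed {k : ℕ} {φ : LA.BoundedFormula Empty k} (h : Delta0 φ) :
    SubstClosed Delta0 φ := by
  induction h with
  | falsum => exact fun m f => ⟨⊥, .falsum, fun M _ v => by simp [Sat]⟩
  | equal t₁ t₂ =>
    refine fun m f => ⟨_, .equal (substT f t₁) (substT f t₂), fun M _ v => ?_⟩
    change tval _ _ = tval _ _ ↔ tval _ _ = tval _ _
    rw [tval_substT, tval_substT]
  | le t₁ t₂ =>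
    refine fun m f => ⟨_, .le (substT f t₁) (substT f t₂), fun M _ v => ?_⟩
    simp only [sat_leF, tval_substT]
  | imp _ _ ih₁ ih₂ =>
    intro m f
    obtain ⟨φ', h1, h2⟩ := ih₁ m f
    obtain ⟨ψ', h3, h4⟩ := ih₂ m f
    refine ⟨_, .imp h1 h3, fun M _ v => ?_⟩
    simp only [Sat, realize_imp] at *
    rw [h2 M v, h4 M v]
  | bdall t _ ih => exact SubstClosed.bdall .bdall t ih

theorem isSigma_isPi_substClosed :
    (∀ {n k} {φ : LA.BoundedFormula Empty k}, IsSigma n φ → SubstClosed (IsSigma n) φ) ∧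
      ∀ {n k} {φ : LA.BoundedFormula Empty k}, IsPi n φ → SubstClosed (IsPi n) φ :=
  hierarchy_induction (S := fun n _ φ => SubstClosed (IsSigma n) φ)
    (P := fun n _ φ => SubstClosed (IsPi n) φ)
    (fun h => h.substClosed.mono .ofDelta0) (fun _ h => h.mono .ofPi) (.ex .ex)
    (.inf .inf) (.sup .sup) (.bdall .bdall)
    (fun h => h.substClosed.mono .ofDelta0) (fun _ h => h.mono .ofSigma) (.all .all)
    (.inf .inf) (.sup .sup) (.bdex .bdex)

/-- `φ` has a formula in the class `C` which is logically equivalent to its negation. -/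
def HasDual (C : ∀ {k : ℕ}, LA.BoundedFormula Empty k → Prop) {k : ℕ}
    (φ : LA.BoundedFormula Empty k) : Prop :=
  ∃ ψ : LA.BoundedFormula Empty k, C ψ ∧
    ∀ (M : Type) [LA.Structure M] (v : Fin k → M), Sat ψ v ↔ ¬ Sat φ v

theorem Delta0.hasDual {k : ℕ} {φ : LA.BoundedFormula Empty k} (h : Delta0 φ) :
    HasDual Delta0 φ :=
  ⟨_, .imp h .falsum, fun _ _ _ => Iff.rfl⟩

theorem isSigma_isPi_hasDual :
    (∀ {n k} {φ : LA.BoundedFormula Empty k}, IsSigma n φ → HasDual (IsPi n) φ) ∧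
      ∀ {n k} {φ : LA.BoundedFormula Empty k}, IsPi n φ → HasDual (IsSigma n) φ := by
  refine hierarchy_induction (S := fun n _ φ => HasDual (IsPi n) φ)
    (P := fun n _ φ => HasDual (IsSigma n) φ) ?_ ?_ ?_ ?_ ?_ ?_ ?_ ?_ ?_ ?_ ?_ ?_
  · exact fun h => let ⟨ψ, h1, h2⟩ := h.hasDual; ⟨ψ, .ofDelta0 h1, h2⟩
  · exact fun _ ⟨ψ, h1, h2⟩ => ⟨ψ, .ofSigma h1, h2⟩
  · exact fun ⟨ψ, h1, h2⟩ => ⟨_, .all h1, fun M _ v => by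
      simp only [Sat, realize_all, realize_ex, not_exists] at *; simp only [h2]⟩
  · exact fun ⟨ψ, h1, h2⟩ ⟨ψ', h1', h2'⟩ => ⟨_, .sup h1 h1', fun M _ v => by
      simp only [Sat, realize_sup, realize_inf, not_and_or] at *; simp only [h2, h2']⟩
  · exact fun ⟨ψ, h1, h2⟩ ⟨ψ', h1', h2'⟩ => ⟨_, .inf h1 h1', fun M _ v => by
      simp only [Sat, realize_sup, realize_inf, not_or] at *; simp only [h2, h2']⟩
  · exact fun t _ ⟨ψ, h1, h2⟩ => ⟨_, .bdex t h1, fun M _ v => by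
      rw [sat_bdall, sat_bdex]; push Not; simp only [h2]⟩
  · exact fun h => let ⟨ψ, h1, h2⟩ := h.hasDual; ⟨ψ, .ofDelta0 h1, h2⟩
  · exact fun _ ⟨ψ, h1, h2⟩ => ⟨ψ, .ofPi h1, h2⟩
  · exact fun ⟨ψ, h1, h2⟩ => ⟨_, .ex h1, fun M _ v => by
      simp only [Sat, realize_all, realize_ex, not_forall] at *; simp only [h2]⟩
  · exact fun ⟨ψ, h1, h2⟩ ⟨ψ', h1', h2'⟩ => ⟨_, .sup h1 h1', fun M _ v => by
      simp only [Sat, realize_sup, realize_inf, not_and_or] at *; simp only [h2, h2']⟩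
  · exact fun ⟨ψ, h1, h2⟩ ⟨ψ', h1', h2'⟩ => ⟨_, .inf h1 h1', fun M _ v => by
      simp only [Sat, realize_sup, realize_inf, not_or] at *; simp only [h2, h2']⟩
  · exact fun t _ ⟨ψ, h1, h2⟩ => ⟨_, .bdall t h1, fun M _ v => by
      rw [sat_bdall, sat_bdex]; push Not; simp only [h2]⟩

/-- The relation `R` on `ℕ` is defined by a formula in the class `C`. -/
def DefBy (C : ∀ {k : ℕ}, LA.BoundedFormula Empty k → Prop) {k : ℕ}
    (R : (Fin k → ℕ) → Prop) : Prop :=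
  ∃ φ : LA.BoundedFormula Empty k, C φ ∧ ∀ v, Sat φ v ↔ R v

/-- The function `g` is given by an `LA`-term in the standard model. -/
def IsPoly {k : ℕ} (g : (Fin k → ℕ) → ℕ) : Prop :=
  ∃ t : LA.Term (Empty ⊕ Fin k), ∀ v, tval t v = g v

section IsPoly

variable {k : ℕ} {f g : (Fin k → ℕ) → ℕ}

theorem IsPoly.proj (i : Fin k) : IsPoly fun v => v i := ⟨&i, fun _ => rfl⟩

theorem IsPoly.zero : IsPoly fun _ : Fin k → ℕ => 0 := ⟨zeroT, fun _ => rfl⟩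

theorem IsPoly.add_one (hf : IsPoly f) : IsPoly fun v => f v + 1 :=
  let ⟨t, ht⟩ := hf
  ⟨succT t, fun v => congrArg (· + 1) (ht v)⟩

theorem IsPoly.add (hf : IsPoly f) (hg : IsPoly g) : IsPoly fun v => f v + g v :=
  let ⟨t, ht⟩ := hf
  let ⟨s, hs⟩ := hg
  ⟨addT t s, fun v => congrArg₂ (· + ·) (ht v) (hs v)⟩

theorem IsPoly.mul (hf : IsPoly f) (hg : IsPoly g) : IsPoly fun v => f v * g v :=
  let ⟨t, ht⟩ := hf
  let ⟨s, hs⟩ := hg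
  ⟨mulT t s, fun v => congrArg₂ (· * ·) (ht v) (hs v)⟩

end IsPoly

section DefBy

variable {C : ∀ {k : ℕ}, LA.BoundedFormula Empty k → Prop} {k : ℕ} {R R' : (Fin k → ℕ) → Prop}

theorem DefBy.congr (h : DefBy C R) (hR : ∀ v, R v ↔ R' v) : DefBy C R' :=
  let ⟨φ, h1, h2⟩ := h
  ⟨φ, h1, fun v => (h2 v).trans (hR v)⟩

theorem DefBy.mono {D : ∀ {k : ℕ}, LA.BoundedFormula Empty k → Prop} (h : DefBy C R)
    (hCD : ∀ {k} {φ : LA.BoundedFormula Empty k}, C φ → D φ) : DefBy D R :=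
  let ⟨φ, h1, h2⟩ := h
  ⟨φ, hCD h1, h2⟩

theorem DefBy.subst (hC : ∀ {k} {φ : LA.BoundedFormula Empty k}, C φ → SubstClosed C φ)
    (h : DefBy C R) {m : ℕ} {g : Fin k → (Fin m → ℕ) → ℕ} (hg : ∀ i, IsPoly (g i)) :
    DefBy C fun v => R fun i => g i v := by
  obtain ⟨φ, h1, h2⟩ := h
  choose t ht using hg
  obtain ⟨ψ, h3, h4⟩ := hC h1 m t
  exact ⟨ψ, h3, fun v => by rw [h4, h2]; simp only [ht]⟩

end DefBy

theorem leM_nat (a b : ℕ) : leM a b ↔ a ≤ b := Iff.rfl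

theorem Delta0.defBy_eq {k : ℕ} {f g : (Fin k → ℕ) → ℕ} (hf : IsPoly f) (hg : IsPoly g) :
    DefBy Delta0 fun v => f v = g v := by
  obtain ⟨t, ht⟩ := hf
  obtain ⟨s, hs⟩ := hg
  refine ⟨_, .equal t s, fun v => ?_⟩
  beta_reduce
  rw [← ht, ← hs]
  exact Iff.rfl

theorem Delta0.defBy_le {k : ℕ} {f g : (Fin k → ℕ) → ℕ} (hf : IsPoly f) (hg : IsPoly g) :
    DefBy Delta0 fun v => f v ≤ g v := by
  obtain ⟨t, ht⟩ := hf
  obtain ⟨s, hs⟩ := hg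
  refine ⟨_, .le t s, fun v => ?_⟩
  rw [sat_leF, leM_nat, ht, hs]

section IsSigma

variable {n k : ℕ} {R R' : (Fin k → ℕ) → Prop}

theorem IsSigma.ofDelta0' {φ : LA.BoundedFormula Empty k} (h : Delta0 φ) : IsSigma (n + 1) φ :=
  .of_one (.ofPi (.ofDelta0 h))

theorem IsSigma.defBy_eq {f g : (Fin k → ℕ) → ℕ} (hf : IsPoly f) (hg : IsPoly g) :
    DefBy (IsSigma (n + 1)) fun v => f v = g v :=
  (Delta0.defBy_eq hf hg).mono .ofDelta0'

theorem IsSigma.defBy_le {f g : (Fin k → ℕ) → ℕ} (hf : IsPoly f) (hg : IsPoly g) :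
    DefBy (IsSigma (n + 1)) fun v => f v ≤ g v :=
  (Delta0.defBy_le hf hg).mono .ofDelta0'

theorem IsSigma.defBy_and (h : DefBy (IsSigma (n + 1)) R) (h' : DefBy (IsSigma (n + 1)) R') :
    DefBy (IsSigma (n + 1)) fun v => R v ∧ R' v :=
  let ⟨_, h1, h2⟩ := h
  let ⟨_, h3, h4⟩ := h'
  ⟨_, .inf h1 h3, fun v => by simp only [Sat, realize_inf] at *; rw [h2, h4]⟩

theorem IsSigma.defBy_or (h : DefBy (IsSigma (n + 1)) R) (h' : DefBy (IsSigma (n + 1)) R') :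
    DefBy (IsSigma (n + 1)) fun v => R v ∨ R' v :=
  let ⟨_, h1, h2⟩ := h
  let ⟨_, h3, h4⟩ := h'
  ⟨_, .sup h1 h3, fun v => by simp only [Sat, realize_sup] at *; rw [h2, h4]⟩

theorem IsSigma.defBy_exists {P : (Fin k → ℕ) → ℕ → Prop}
    (h : DefBy (IsSigma (n + 1)) fun w : Fin (k + 1) → ℕ =>
      P (fun i => w i.castSucc) (w (Fin.last k))) :
    DefBy (IsSigma (n + 1)) fun v => ∃ a, P v a := by
  obtain ⟨φ, h1, h2⟩ := h
  refine ⟨_, .ex h1, fun v => ?_⟩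
  simp only [Sat, realize_ex] at *
  simp [h2]

theorem IsSigma.defBy_forall_le {P : (Fin k → ℕ) → ℕ → Prop} {g : (Fin k → ℕ) → ℕ}
    (hg : IsPoly g)
    (h : DefBy (IsSigma (n + 1)) fun w : Fin (k + 1) → ℕ =>
      P (fun i => w i.castSucc) (w (Fin.last k))) :
    DefBy (IsSigma (n + 1)) fun v => ∀ a ≤ g v, P v a := by
  obtain ⟨φ, h1, h2⟩ := h
  obtain ⟨t, ht⟩ := hg
  refine ⟨_, .bdall t h1, fun v => ?_⟩
  rw [sat_bdall]
  simp only [leM_nat, ht, h2, Fin.snoc_castSucc, Fin.snoc_last]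

theorem IsSigma.defBy_subst (h : DefBy (IsSigma n) R) {m : ℕ} {g : Fin k → (Fin m → ℕ) → ℕ}
    (hg : ∀ i, IsPoly (g i)) : DefBy (IsSigma n) fun v => R fun i => g i v :=
  h.subst isSigma_isPi_substClosed.1 hg

theorem IsSigma.defBy_exists_vec (l : ℕ) : ∀ {k : ℕ} {P : (Fin k → ℕ) → (Fin l → ℕ) → Prop},
    (DefBy (IsSigma (n + 1)) fun w : Fin (k + l) → ℕ =>
      P (fun i => w (i.castAdd l)) (fun j => w (j.natAdd k))) →
    DefBy (IsSigma (n + 1)) fun v => ∃ a, P v a := by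
  induction l with
  | zero =>
    intro k P h
    refine h.congr fun v => ⟨fun h => ⟨_, h⟩, fun ⟨a, h⟩ => ?_⟩
    rwa [Subsingleton.elim a] at h
  | succ l ih =>
    intro k P h
    have h' : DefBy (IsSigma (n + 1)) fun w : Fin (k + l) → ℕ => ∃ b,
        P (fun i => w (i.castAdd l)) (Fin.snoc (fun j : Fin l => w (j.natAdd k)) b) := by
      refine IsSigma.defBy_exists
        (P := fun w b => P (fun i => w (i.castAdd l)) (Fin.snoc (fun j => w (j.natAdd k)) b)) ?_
      refine h.congr fun w => iff_of_eq (congrArg _ ?_)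
      funext j
      refine Fin.lastCases ?_ (fun j => ?_) j
      · simp
      · simp
    refine (ih (P := fun v a => ∃ b, P v (Fin.snoc a b)) h').congr fun v => ?_
    exact ⟨fun ⟨a, b, h⟩ => ⟨_, h⟩, fun ⟨a, h⟩ => ⟨Fin.init a, a (Fin.last l), by simpa using h⟩⟩

end IsSigma

theorem Delta0.isSigma_and_isPi {k : ℕ} {φ : LA.BoundedFormula Empty k} (h : Delta0 φ) (n : ℕ) :
    IsSigma n φ ∧ IsPi n φ := by
  induction n with
  | zero => exact ⟨.ofDelta0 h, .ofDelta0 h⟩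
  | succ n ih => exact ⟨.ofPi ih.2, .ofSigma ih.1⟩

section IsPi

variable {n k : ℕ} {R R' : (Fin k → ℕ) → Prop}

theorem IsPi.defBy_and (h : DefBy (IsPi n) R) (h' : DefBy (IsPi n) R') :
    DefBy (IsPi n) fun v => R v ∧ R' v := by
  obtain ⟨φ, h1, h2⟩ := h
  obtain ⟨ψ, h3, h4⟩ := h'
  refine ⟨φ ⊓ ψ, ?_, fun v => by simp only [Sat, realize_inf] at *; rw [h2, h4]⟩
  cases n with
  | succ n => exact .inf h1 h3
  | zero =>
    cases h1 with | ofDelta0 h1 =>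
    cases h3 with | ofDelta0 h3 =>
    exact .ofDelta0 (.imp (.imp h1 (.imp h3 .falsum)) .falsum)

theorem IsPi.defBy_or (h : DefBy (IsPi n) R) (h' : DefBy (IsPi n) R') :
    DefBy (IsPi n) fun v => R v ∨ R' v := by
  obtain ⟨φ, h1, h2⟩ := h
  obtain ⟨ψ, h3, h4⟩ := h'
  refine ⟨φ ⊔ ψ, ?_, fun v => by simp only [Sat, realize_sup] at *; rw [h2, h4]⟩
  cases n with
  | succ n => exact .sup h1 h3
  | zero =>
    cases h1 with | ofDelta0 h1 =>
    cases h3 with | ofDelta0 h3 =>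
    exact .ofDelta0 (.imp (.imp h1 .falsum) h3)

theorem IsPi.defBy_exists_le {P : (Fin k → ℕ) → ℕ → Prop} {g : (Fin k → ℕ) → ℕ} (hg : IsPoly g)
    (h : DefBy (IsPi n) fun w : Fin (k + 1) → ℕ =>
      P (fun i => w i.castSucc) (w (Fin.last k))) :
    DefBy (IsPi n) fun v => ∃ a ≤ g v, P v a := by
  obtain ⟨φ, h1, h2⟩ := h
  obtain ⟨t, ht⟩ := hg
  have key (v : Fin k → ℕ) : Sat (leF (&(Fin.last k)) (liftT t) ⊓ φ).ex v ↔ ∃ a ≤ g v, P v a := by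
    rw [sat_bdex]
    simp only [leM_nat, ht, h2, Fin.snoc_castSucc, Fin.snoc_last]
  cases n with
  | succ n => exact ⟨_, .bdex t h1, key⟩
  | zero =>
    cases h1 with | ofDelta0 h1 =>
    refine ⟨∼(leF (&(Fin.last k)) (liftT t) ⟹ ∼φ).all,
      .ofDelta0 (.imp (.bdall t (.imp h1 .falsum)) .falsum), fun v => ?_⟩
    beta_reduce
    rw [← key, Sat, realize_not, ← Sat, sat_bdall, sat_bdex]
    simp

theorem IsPi.defBy_forall_le {P : (Fin k → ℕ) → ℕ → Prop} {g : (Fin k → ℕ) → ℕ} (hg : IsPoly g)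
    (h : DefBy (IsPi n) fun w : Fin (k + 1) → ℕ =>
      P (fun i => w i.castSucc) (w (Fin.last k))) :
    DefBy (IsPi n) fun v => ∀ a ≤ g v, P v a := by
  obtain ⟨φ, h1, h2⟩ := h
  obtain ⟨t, ht⟩ := hg
  have key (v : Fin k → ℕ) :
      Sat (leF (&(Fin.last k)) (liftT t) ⟹ φ).all v ↔ ∀ a ≤ g v, P v a := by
    rw [sat_bdall]
    simp only [leM_nat, ht, h2, Fin.snoc_castSucc, Fin.snoc_last]
  cases n with
  | zero =>
    cases h1 with | ofDelta0 h1 =>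
    exact ⟨_, .ofDelta0 (.bdall t h1), key⟩
  | succ n =>
    refine ⟨(∼(leF (&(Fin.last k)) (liftT t)) ⊔ φ).all, .all (.sup ?_ h1), fun v => ?_⟩
    · exact (Delta0.imp (.le _ _) .falsum).isSigma_and_isPi _ |>.2
    · beta_reduce
      rw [← key]
      simp only [Sat, realize_all, realize_sup, realize_not, realize_imp, imp_iff_not_or]

theorem IsPi.defBy_subst (h : DefBy (IsPi n) R) {m : ℕ} {g : Fin k → (Fin m → ℕ) → ℕ}
    (hg : ∀ i, IsPoly (g i)) : DefBy (IsPi n) fun v => R fun i => g i v :=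
  h.subst isSigma_isPi_substClosed.2 hg

theorem IsPi.defBy_swap {Q : (Fin (k + 1) → ℕ) → ℕ → Prop}
    (h : DefBy (IsPi n) fun w : Fin (k + 2) → ℕ => Q (fun i => w i.castSucc) (w (Fin.last _))) :
    DefBy (IsPi n) fun w : Fin (k + 2) → ℕ =>
      Q (Fin.snoc (α := fun _ => ℕ) (fun i : Fin k => w i.castSucc.castSucc) (w (Fin.last _)))
        (w (Fin.last k).castSucc) := by
  refine (IsPi.defBy_subst h (m := k + 2)
    (g := Fin.snoc (α := fun _ => (Fin (k + 2) → ℕ) → ℕ)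
      (Fin.snoc (α := fun _ => (Fin (k + 2) → ℕ) → ℕ)
      (fun i w => w i.castSucc.castSucc) (fun w => w (Fin.last _)))
      (fun w => w (Fin.last k).castSucc)) ?_).congr fun w => ?_
  · intro i
    refine Fin.lastCases ?_ (fun i => ?_) i
    · simpa using IsPoly.proj _
    · refine Fin.lastCases ?_ (fun i => ?_) i
      · simpa using IsPoly.proj _
      · simpa using IsPoly.proj _
  · simp only [Fin.snoc_castSucc, Fin.snoc_last]
    refine iff_of_eq (congrArg (fun u => Q u _) ?_)
    funext i
    refine Fin.lastCases ?_ (fun i => ?_) i <;> simp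

end IsPi

/-- `R` is the projection of an increasing family of `Πₙ`-definable relations. -/
def IsPiProj (n : ℕ) {k : ℕ} (R : (Fin k → ℕ) → Prop) : Prop :=
  ∃ Q : (Fin k → ℕ) → ℕ → Prop,
    (DefBy (IsPi n) fun w : Fin (k + 1) → ℕ => Q (fun i => w i.castSucc) (w (Fin.last k))) ∧
    (∀ v y z, y ≤ z → Q v y → Q v z) ∧ ∀ v, R v ↔ ∃ y, Q v y

theorem IsPiProj.exists {n k : ℕ} {P : (Fin k → ℕ) → ℕ → Prop}
    (h : IsPiProj n fun w : Fin (k + 1) → ℕ => P (fun i => w i.castSucc) (w (Fin.last k))) :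
    IsPiProj n fun v => ∃ a, P v a := by
  obtain ⟨Q, h1, h2, h3⟩ := h
  refine ⟨fun v y => ∃ a ≤ y, Q (Fin.snoc (α := fun _ => ℕ) v a) y, ?_, ?_, ?_⟩
  · refine IsPi.defBy_exists_le
      (P := fun w a => Q (Fin.snoc (α := fun _ => ℕ) (fun i : Fin k => w i.castSucc) a)
        (w (Fin.last k))) (IsPoly.proj _) ?_
    exact IsPi.defBy_swap h1
  · exact fun v y z hyz ⟨a, ha, h⟩ => ⟨a, ha.trans hyz, h2 _ _ _ hyz h⟩
  · intro v
    have h3' (a : ℕ) := h3 (Fin.snoc (α := fun _ => ℕ) v a)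
    simp only [Fin.snoc_castSucc, Fin.snoc_last] at h3'
    simp only [h3']
    exact ⟨fun ⟨a, y, h⟩ => ⟨max a y, a, le_max_left _ _, h2 _ _ _ (le_max_right _ _) h⟩,
      fun ⟨y, a, _, h⟩ => ⟨a, y, h⟩⟩

theorem IsPiProj.forall_le {n k : ℕ} {P : (Fin k → ℕ) → ℕ → Prop} {g : (Fin k → ℕ) → ℕ}
    (hg : IsPoly g)
    (h : IsPiProj n fun w : Fin (k + 1) → ℕ => P (fun i => w i.castSucc) (w (Fin.last k))) :
    IsPiProj n fun v => ∀ a ≤ g v, P v a := by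
  obtain ⟨Q, h1, h2, h3⟩ := h
  refine ⟨fun v y => ∀ a ≤ g v, Q (Fin.snoc (α := fun _ => ℕ) v a) y, ?_, ?_, ?_⟩
  · have hg' : IsPoly fun w : Fin (k + 1) → ℕ => g fun i => w i.castSucc := by
      obtain ⟨t, ht⟩ := hg
      exact ⟨substT (fun i => &i.castSucc) t, fun w => by rw [tval_substT]; exact ht _⟩
    refine IsPi.defBy_forall_le
      (P := fun w a => Q (Fin.snoc (α := fun _ => ℕ) (fun i : Fin k => w i.castSucc) a)
        (w (Fin.last k))) hg' ?_
    exact IsPi.defBy_swap h1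
  · exact fun v y z hyz h a ha => h2 _ _ _ hyz (h a ha)
  · intro v
    have h3' (a : ℕ) := h3 (Fin.snoc (α := fun _ => ℕ) v a)
    simp only [Fin.snoc_castSucc, Fin.snoc_last] at h3'
    simp only [h3']
    refine ⟨fun h => ?_, fun ⟨y, h⟩ a ha => ⟨y, h a ha⟩⟩
    choose! y hy using h
    exact ⟨(Finset.range (g v + 1)).sup y, fun a ha => h2 _ _ _
      (Finset.le_sup (Finset.mem_range.2 (Nat.lt_succ_of_le ha))) (hy a ha)⟩

theorem IsPiProj.congr {n k : ℕ} {R R' : (Fin k → ℕ) → Prop} (h : IsPiProj n R)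
    (hR : ∀ v, R v ↔ R' v) : IsPiProj n R' :=
  let ⟨Q, h1, h2, h3⟩ := h
  ⟨Q, h1, h2, fun v => (hR v).symm.trans (h3 v)⟩

theorem isPiProj_of_isSigma {n k : ℕ} {φ : LA.BoundedFormula Empty k} (h : IsSigma n φ) :
    ∀ m, n = m + 1 → IsPiProj m fun v : Fin k → ℕ => Sat φ v := by
  refine (hierarchy_induction
    (S := fun n k φ => ∀ m, n = m + 1 → IsPiProj m fun v : Fin k → ℕ => Sat φ v)
    (P := fun _ _ _ => True) ?_ ?_ ?_ ?_ ?_ ?_ ?_ ?_ ?_ ?_ ?_ ?_).1 h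
  · intro k φ _ m hm
    omega
  · rintro n k φ h - m hm
    obtain rfl : n = m := by omega
    exact ⟨fun v _ => Sat φ v, IsPi.defBy_subst ⟨φ, h, fun _ => Iff.rfl⟩ fun i => .proj _,
      fun _ _ _ _ h => h, fun v => by simp⟩
  · intro n k φ ih m hm
    have := ih m hm
    refine (IsPiProj.exists (P := fun v a => Sat φ (Fin.snoc v a : Fin (k + 1) → ℕ)) ?_).congr
      fun v => by simp only [Sat, realize_ex]
    exact this.congr fun w => iff_of_eq (congrArg _ (Fin.snoc_init_self w).symm)
  · intro n k φ ψ ih₁ ih₂ m hm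
    obtain ⟨Q, h1, h2, h3⟩ := ih₁ m hm
    obtain ⟨Q', h1', h2', h3'⟩ := ih₂ m hm
    refine ⟨fun v y => Q v y ∧ Q' v y, IsPi.defBy_and h1 h1',
      fun v y z hyz h => ⟨h2 _ _ _ hyz h.1, h2' _ _ _ hyz h.2⟩, fun v => ?_⟩
    simp only [Sat, realize_inf] at *
    rw [h3, h3']
    exact ⟨fun ⟨⟨y, h⟩, z, h'⟩ => ⟨max y z, h2 _ _ _ (le_max_left _ _) h,
      h2' _ _ _ (le_max_right _ _) h'⟩, fun ⟨y, h, h'⟩ => ⟨⟨y, h⟩, y, h'⟩⟩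
  · intro n k φ ψ ih₁ ih₂ m hm
    obtain ⟨Q, h1, h2, h3⟩ := ih₁ m hm
    obtain ⟨Q', h1', h2', h3'⟩ := ih₂ m hm
    refine ⟨fun v y => Q v y ∨ Q' v y, IsPi.defBy_or h1 h1',
      fun v y z hyz h => h.imp (h2 _ _ _ hyz) (h2' _ _ _ hyz), fun v => ?_⟩
    simp only [Sat, realize_sup] at *
    rw [h3, h3', exists_or]
  · intro n k t φ ih m hm
    have := ih m hm
    refine (IsPiProj.forall_le (P := fun v a => Sat φ (Fin.snoc v a : Fin (k + 1) → ℕ))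
      ⟨t, fun _ => rfl⟩ ?_).congr fun v => by rw [sat_bdall]; rfl
    exact this.congr fun w => iff_of_eq (congrArg _ (Fin.snoc_init_self w).symm)
  all_goals intros; trivial

/-- The graph of `F` is `Σ₁`-definable. -/
def SigmaFun {k : ℕ} (F : (Fin k → ℕ) → ℕ) : Prop :=
  DefBy (IsSigma 1) fun w : Fin (k + 1) → ℕ => F (fun i => w i.castSucc) = w (Fin.last k)

section SigmaFun

variable {k l : ℕ}

theorem IsSigma.defBy_forall_fin {n : ℕ} {R : Fin l → (Fin k → ℕ) → Prop}
    (h : ∀ i, DefBy (IsSigma (n + 1)) (R i)) : DefBy (IsSigma (n + 1)) fun v => ∀ i, R i v := by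
  induction l with
  | zero => exact (IsSigma.defBy_eq .zero .zero).congr fun v => by simp
  | succ l ih =>
    exact (IsSigma.defBy_and (h 0) (ih fun i => h i.succ)).congr fun v => by
      rw [Fin.forall_fin_succ]

theorem IsPoly.sigmaFun {F : (Fin k → ℕ) → ℕ} (h : IsPoly F) : SigmaFun F := by
  obtain ⟨t, ht⟩ := h
  refine IsSigma.defBy_eq ⟨substT (fun i => &i.castSucc) t, fun w => ?_⟩ (.proj _)
  rw [tval_substT]
  exact ht _

theorem SigmaFun.defBy {n : ℕ} {R : (Fin l → ℕ) → Prop} {F : Fin l → (Fin k → ℕ) → ℕ}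
    (hR : DefBy (IsSigma (n + 1)) R) (hF : ∀ i, SigmaFun (F i)) :
    DefBy (IsSigma (n + 1)) fun v => R fun i => F i v := by
  have h : DefBy (IsSigma (n + 1)) fun w : Fin (k + l) → ℕ =>
      (∀ i, F i (fun i => w (i.castAdd l)) = w (i.natAdd k)) ∧ R fun j => w (j.natAdd k) := by
    refine IsSigma.defBy_and (IsSigma.defBy_forall_fin fun i => ?_)
      (IsSigma.defBy_subst hR fun i => .proj _)
    refine (IsSigma.defBy_subst ((hF i).mono .of_one)
      (g := Fin.snoc (α := fun _ => (Fin (k + l) → ℕ) → ℕ) (fun i w => w (i.castAdd l))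
        (fun w => w (i.natAdd k))) (fun j => ?_)).congr fun w => by simp
    refine Fin.lastCases ?_ (fun j => ?_) j <;> simpa using IsPoly.proj _
  refine (IsSigma.defBy_exists_vec l
    (P := fun v a => (∀ i, F i v = a i) ∧ R a) h).congr fun v => ?_
  exact ⟨fun ⟨a, h, ha⟩ => (funext h : (fun i => F i v) = a) ▸ ha, fun h => ⟨_, fun _ => rfl, h⟩⟩

theorem SigmaFun.reindex {F : (Fin l → ℕ) → ℕ} (h : SigmaFun F) (s : Fin l → Fin k) :
    SigmaFun fun v => F fun i => v (s i) := by
  refine (IsSigma.defBy_subst h (g := Fin.snoc (α := fun _ => (Fin (k + 1) → ℕ) → ℕ)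
    (fun i w => w (s i).castSucc) (fun w => w (Fin.last k))) fun j => ?_).congr fun w => by simp
  refine Fin.lastCases ?_ (fun j => ?_) j <;> simpa using IsPoly.proj _

theorem SigmaFun.comp {G : (Fin l → ℕ) → ℕ} {F : Fin l → (Fin k → ℕ) → ℕ}
    (hG : SigmaFun G) (hF : ∀ i, SigmaFun (F i)) : SigmaFun fun v => G fun i => F i v := by
  refine (SigmaFun.defBy hG (F := Fin.snoc (α := fun _ => (Fin (k + 1) → ℕ) → ℕ)
    (fun i w => F i fun i => w i.castSucc) (fun w => w (Fin.last k))) fun j => ?_).congr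
      fun w => by simp
  refine Fin.lastCases ?_ (fun j => ?_) j
  · simpa using (IsPoly.proj _).sigmaFun
  · simpa using (hF j).reindex Fin.castSucc

theorem SigmaFun.defBy_eq {n : ℕ} {F G : (Fin k → ℕ) → ℕ} (hF : SigmaFun F) (hG : SigmaFun G) :
    DefBy (IsSigma (n + 1)) fun v => F v = G v :=
  (SigmaFun.defBy (R := fun w : Fin 2 → ℕ => w 0 = w 1) (F := ![F, G])
    (IsSigma.defBy_eq (.proj _) (.proj _)) (by
      intro i; fin_cases i; exacts [hF, hG])).congr fun v => by simp

theorem sigmaFun_beta : SigmaFun fun v : Fin 3 → ℕ => v 0 % ((v 2 + 1) * v 1 + 1) := by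
  refine (IsSigma.defBy_exists (P := fun w q => w 0 = q * ((w 2 + 1) * w 1 + 1) + w 3 ∧
    w 3 + 1 ≤ (w 2 + 1) * w 1 + 1) ?_).congr fun v => ?_
  · refine IsSigma.defBy_and (IsSigma.defBy_eq (.proj _) ?_) (IsSigma.defBy_le ?_ ?_)
    · exact ((IsPoly.proj _).mul ((((IsPoly.proj _).add_one).mul (.proj _)).add_one)).add (.proj _)
    · exact (IsPoly.proj _).add_one
    · exact (((IsPoly.proj _).add_one).mul (.proj _)).add_one
  · change _ ↔ v 0 % ((v 2 + 1) * v 1 + 1) = v 3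
    generalize (v 2 + 1) * v 1 = m
    constructor
    · rintro ⟨q, h, h'⟩
      rw [h, Nat.mul_add_mod', Nat.mod_eq_of_lt (by omega)]
    · intro h
      refine ⟨v 0 / (m + 1), ?_, ?_⟩
      · rw [← h, Nat.div_add_mod']
      · rw [← h]
        exact Nat.mod_lt _ (Nat.succ_pos m)

theorem exists_beta (f : ℕ → ℕ) (m : ℕ) : ∃ c d, ∀ i ≤ m, c % ((i + 1) * d + 1) = f i := by
  let u := Nat.unbeta ((List.range (m + 1)).map f)
  refine ⟨u.unpair.1, u.unpair.2, fun i hi => ?_⟩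
  have := Nat.beta_unbeta_coe ((List.range (m + 1)).map f) ⟨i, by simp; omega⟩
  simpa [Nat.beta] using this

theorem SigmaFun.beta {c d i : (Fin k → ℕ) → ℕ} (hc : IsPoly c) (hd : IsPoly d) (hi : IsPoly i) :
    SigmaFun fun v => c v % ((i v + 1) * d v + 1) := by
  refine SigmaFun.comp (F := ![c, d, i]) sigmaFun_beta fun j => ?_
  fin_cases j
  exacts [hc.sigmaFun, hd.sigmaFun, hi.sigmaFun]

theorem SigmaFun.prec {F : (Fin k → ℕ) → ℕ} {G : (Fin (k + 2) → ℕ) → ℕ} (hF : SigmaFun F)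
    (hG : SigmaFun G) : SigmaFun fun v : Fin (k + 1) → ℕ =>
      (v 0).rec (F fun i => v i.succ)
        fun y a => G (Fin.cons y (Fin.cons a fun i => v i.succ)) := by
  refine (IsSigma.defBy_exists (P := fun w c => ∃ d,
    c % ((0 + 1) * d + 1) = F (fun i => w i.succ.castSucc) ∧
    c % ((w 0 + 1) * d + 1) = w (Fin.last _) ∧
    ∀ i ≤ w 0, i = w 0 ∨ c % ((i + 1 + 1) * d + 1) =
      G (Fin.cons i (Fin.cons (c % ((i + 1) * d + 1)) fun i => w i.succ.castSucc))) ?_).congr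
      fun w => ?_
  · refine IsSigma.defBy_exists (P := fun w d =>
      w (Fin.last _) % ((0 + 1) * d + 1) = F (fun i => w i.succ.castSucc.castSucc) ∧
      w (Fin.last _) % ((w 0 + 1) * d + 1) = w (Fin.last _).castSucc ∧
      ∀ i ≤ w 0, i = w 0 ∨ w (Fin.last _) % ((i + 1 + 1) * d + 1) =
        G (Fin.cons i (Fin.cons (w (Fin.last _) % ((i + 1) * d + 1))
          fun i => w i.succ.castSucc.castSucc))) ?_
    refine IsSigma.defBy_and ?_ (IsSigma.defBy_and ?_ ?_)
    · exact SigmaFun.defBy_eq (SigmaFun.beta (.proj _) (.proj _) .zero) (hF.reindex _)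
    · exact SigmaFun.defBy_eq (SigmaFun.beta (.proj _) (.proj _) (.proj _))
        (IsPoly.proj _).sigmaFun
    · refine IsSigma.defBy_forall_le (P := fun w i => i = w 0 ∨
        w (Fin.last _).castSucc % ((i + 1 + 1) * w (Fin.last _) + 1) =
        G (Fin.cons i (Fin.cons (w (Fin.last _).castSucc % ((i + 1) * w (Fin.last _) + 1))
          fun i => w i.succ.castSucc.castSucc.castSucc))) (.proj _) ?_
      refine IsSigma.defBy_or (IsSigma.defBy_eq (.proj _) (.proj _)) ?_
      refine SigmaFun.defBy_eq
        (SigmaFun.beta (.proj _) (.proj _) (.add_one (.proj _))) ?_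
      refine cast (congrArg SigmaFun (funext fun w => congrArg G ?_)) <|
        SigmaFun.comp (F := Fin.cons (α := fun _ => (Fin (k + 1 + 1 + 1 + 1 + 1) → ℕ) → ℕ)
        (fun w => w (Fin.last _)) (Fin.cons (α := fun _ => (Fin (k + 1 + 1 + 1 + 1 + 1) → ℕ) → ℕ)
          (fun w => w (Fin.last _).castSucc.castSucc %
            ((w (Fin.last _) + 1) * w (Fin.last _).castSucc + 1))
          fun i w => w i.succ.castSucc.castSucc.castSucc.castSucc)) hG fun j => ?_
      · funext j
        refine Fin.cases ?_ (fun j => Fin.cases ?_ (fun j => ?_) j) j <;> simp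
      · refine Fin.cases ?_ (fun j => Fin.cases ?_ (fun j => ?_) j) j
        · exact (IsPoly.proj _).sigmaFun
        · exact SigmaFun.beta (.proj _) (.proj _) (.proj _)
        · exact (IsPoly.proj _).sigmaFun
  · set r : ℕ → ℕ := fun m => m.rec (F fun i => w i.succ.castSucc)
      fun y a => G (Fin.cons y (Fin.cons a fun i => w i.succ.castSucc)) with hr
    change _ ↔ r (w 0) = w (Fin.last _)
    constructor
    · rintro ⟨c, d, h0, h1, h2⟩
      rw [← h1]
      have key (i : ℕ) (hi : i ≤ w 0) : c % ((i + 1) * d + 1) = r i := by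
        induction i with
        | zero => exact h0
        | succ i ih =>
          obtain h | h := h2 i (by omega)
          · omega
          · rw [h, ih (by omega)]
      exact (key _ le_rfl).symm
    · intro h
      obtain ⟨c, d, hcd⟩ := exists_beta r (w 0)
      refine ⟨c, d, hcd 0 (Nat.zero_le _), (hcd _ le_rfl).trans h, fun i hi => ?_⟩
      obtain h | h := hi.eq_or_lt
      · exact .inl h
      · right
        rw [hcd _ h, hcd _ hi]

theorem sigmaFun_of_primrec' {n : ℕ} {f : List.Vector ℕ n → ℕ} (hf : Nat.Primrec' f) :
    SigmaFun fun v => f (List.Vector.ofFn v) := by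
  induction hf with
  | zero => exact IsPoly.zero.sigmaFun
  | succ => exact (IsPoly.proj 0).add_one.sigmaFun
  | get i => simpa using (IsPoly.proj i).sigmaFun
  | comp g _ _ ihf ihg => exact ihf.comp ihg
  | prec _ _ ihf ihg => exact ihf.prec ihg

/-- Primitive recursive relations are `Σ₁`-definable. -/
theorem defBy_of_primrecRel {n : ℕ} {R : ℕ → ℕ → Prop} (hR : PrimrecRel R) :
    DefBy (IsSigma (n + 1)) fun v : Fin 2 → ℕ => R (v 0) (v 1) := by
  classical
  have h1 : Primrec fun v : List.Vector ℕ 2 => if R (v.get 0) (v.get 1) then 0 else 1 :=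
    Primrec.ite (hR.comp (Primrec.vector_get.comp .id (.const 0))
      (Primrec.vector_get.comp .id (.const 1))) (.const 0) (.const 1)
  have h2 := sigmaFun_of_primrec' (Nat.Primrec'.of_prim h1)
  refine (SigmaFun.defBy_eq h2 IsPoly.zero.sigmaFun).congr fun v => ?_
  simp

end SigmaFun

section Model

variable {M : Type} [LA.Structure M]

/-- The interpretation of `0`. -/
abbrev zeroM : M := Structure.funMap (L := LA) (ArithFunc.zero : LA.Functions 0) ![]
/-- The interpretation of `S`. -/
abbrev succM (a : M) : M := Structure.funMap (L := LA) (ArithFunc.succ : LA.Functions 1) ![a]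
/-- The interpretation of `+`. -/
abbrev addM (a b : M) : M := Structure.funMap (L := LA) (ArithFunc.add : LA.Functions 2) ![a, b]
/-- The interpretation of `×`. -/
abbrev mulM (a b : M) : M := Structure.funMap (L := LA) (ArithFunc.mul : LA.Functions 2) ![a, b]

variable {α : Type} (v : α → M)

@[simp]
theorem realize_zeroT : (zeroT : LA.Term α).realize v = zeroM :=
  congrArg (Structure.funMap _) (Subsingleton.elim _ _)

@[simp]
theorem realize_succT (t : LA.Term α) : (succT t).realize v = succM (t.realize v) :=
  congrArg (Structure.funMap _) (by funext i; fin_cases i; rfl)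

@[simp]
theorem realize_addT (t s : LA.Term α) :
    (addT t s).realize v = addM (t.realize v) (s.realize v) :=
  congrArg (Structure.funMap _) (by funext i; fin_cases i <;> rfl)

@[simp]
theorem realize_mulT (t s : LA.Term α) :
    (mulT t s).realize v = mulM (t.realize v) (s.realize v) :=
  congrArg (Structure.funMap _) (by funext i; fin_cases i <;> rfl)

/-- The standard elements of an `LA`-structure. -/
def num (M : Type) [LA.Structure M] : ℕ → M
  | 0 => zeroM
  | n + 1 => succM (num M n)

/-- The axioms of Robinson arithmetic, unfolded in a structure. -/
structure IsQ (M : Type) [LA.Structure M] : Prop where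
  succ_ne (a : M) : succM a ≠ zeroM
  succ_inj (a b : M) : succM a = succM b → a = b
  eq_succ (a : M) : a ≠ zeroM → ∃ b, a = succM b
  add_zero (a : M) : addM a zeroM = a
  add_succ (a b : M) : addM a (succM b) = succM (addM a b)
  mul_zero (a : M) : mulM a zeroM = zeroM
  mul_succ (a b : M) : mulM a (succM b) = addM (mulM a b) a
  le_iff (a b : M) : leM a b ↔ ∃ c, addM c a = b

theorem isQ_of_model (h : M ⊨ QTheory) : IsQ M := by
  simp only [QTheory, Theory.model_iff, Set.mem_insert_iff, Set.mem_singleton_iff,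
    forall_eq_or_imp, forall_eq] at h
  obtain ⟨h1, h2, h3, h4, h5, h6, h7, h8⟩ := h
  constructor
  · intro a
    simpa [Sentence.Realize, Formula.Realize, Fin.snoc] using h1 a
  · intro a b
    simpa [Sentence.Realize, Formula.Realize, Fin.snoc] using h2 a b
  · intro a
    simpa [Sentence.Realize, Formula.Realize, Fin.snoc] using h3 a
  · intro a
    simpa [Sentence.Realize, Formula.Realize, Fin.snoc] using h4 a
  · intro a b
    simpa [Sentence.Realize, Formula.Realize, Fin.snoc] using h5 a b
  · intro a
    simpa [Sentence.Realize, Formula.Realize, Fin.snoc] using h6 a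
  · intro a b
    simpa [Sentence.Realize, Formula.Realize, Fin.snoc] using h7 a b
  · intro a b
    have := (realize_alls.1 h8) ![a, b]
    rw [realize_iff] at this
    have h9 := sat_leF (&0) (&1) ![a, b]
    simp only [Sat] at h9
    rw [Subsingleton.elim default (default : Empty → M)] at this
    rw [h9] at this
    simpa [Fin.snoc] using this

theorem IsQ.addM_num (h : IsQ M) (a b : ℕ) : addM (num M a) (num M b) = num M (a + b) := by
  induction b with
  | zero => exact h.add_zero _
  | succ b ih => exact (h.add_succ _ _).trans (congrArg succM ih)

theorem IsQ.mulM_num (h : IsQ M) (a b : ℕ) : mulM (num M a) (num M b) = num M (a * b) := by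
  induction b with
  | zero => exact h.mul_zero _
  | succ b ih => rw [num, h.mul_succ, ih, h.addM_num, Nat.mul_succ]

theorem IsQ.leM_num_iff (h : IsQ M) (x : M) (k : ℕ) :
    leM x (num M k) ↔ ∃ j ≤ k, x = num M j := by
  constructor
  · induction k generalizing x with
    | zero =>
      intro hx
      obtain ⟨c, hc⟩ := (h.le_iff _ _).1 hx
      by_cases hx : x = zeroM
      · exact ⟨0, le_rfl, hx⟩
      · obtain ⟨b, rfl⟩ := h.eq_succ x hx
        rw [h.add_succ] at hc
        exact (h.succ_ne _ hc).elim
    | succ k ih =>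
      intro hx
      obtain ⟨c, hc⟩ := (h.le_iff _ _).1 hx
      by_cases hx : x = zeroM
      · exact ⟨0, Nat.zero_le _, hx⟩
      · obtain ⟨b, rfl⟩ := h.eq_succ x hx
        rw [h.add_succ] at hc
        obtain ⟨j, hj, rfl⟩ := ih b ((h.le_iff _ _).2 ⟨c, h.succ_inj _ _ hc⟩)
        exact ⟨j + 1, by omega, rfl⟩
  · rintro ⟨j, hj, rfl⟩
    exact (h.le_iff _ _).2 ⟨num M (k - j), by rw [h.addM_num, Nat.sub_add_cancel hj]⟩

theorem IsQ.leM_num_total (h : IsQ M) (y : M) (p : ℕ) : leM y (num M p) ∨ leM (num M p) y := by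
  induction p generalizing y with
  | zero => exact .inr ((h.le_iff _ _).2 ⟨y, h.add_zero y⟩)
  | succ p ih =>
    by_cases hy : y = zeroM
    · exact .inl ((h.leM_num_iff _ _).2 ⟨0, Nat.zero_le _, hy⟩)
    · obtain ⟨b, rfl⟩ := h.eq_succ y hy
      refine (ih b).imp (fun hb => ?_) fun hb => ?_
      · obtain ⟨j, hj, rfl⟩ := (h.leM_num_iff _ _).1 hb
        exact (h.leM_num_iff _ _).2 ⟨j + 1, by omega, rfl⟩
      · obtain ⟨c, rfl⟩ := (h.le_iff _ _).1 hb
        exact (h.le_iff _ _).2 ⟨c, h.add_succ _ _⟩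

theorem IsQ.realize_num (h : IsQ M) (t : LA.Term α) (v : α → ℕ) :
    t.realize (fun i => num M (v i)) = num M (t.realize v) := by
  induction t with
  | var i => rfl
  | @func l f ts ih =>
    cases f with
    | zero => exact congrArg (Structure.funMap _) (Subsingleton.elim _ _)
    | succ =>
      refine Eq.trans (congrArg (Structure.funMap _) (?_ : _ = ![num M ((ts 0).realize v)])) rfl
      funext i; fin_cases i; exact ih 0
    | add =>
      refine Eq.trans (congrArg (Structure.funMap _)
        (?_ : _ = ![num M ((ts 0).realize v), num M ((ts 1).realize v)])) (h.addM_num _ _)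
      funext i; fin_cases i; exacts [ih 0, ih 1]
    | mul =>
      refine Eq.trans (congrArg (Structure.funMap _)
        (?_ : _ = ![num M ((ts 0).realize v), num M ((ts 1).realize v)])) (h.mulM_num _ _)
      funext i; fin_cases i; exacts [ih 0, ih 1]

theorem IsQ.tval_num (h : IsQ M) {k : ℕ} (t : LA.Term (Empty ⊕ Fin k)) (v : Fin k → ℕ) :
    tval t (fun i => num M (v i)) = num M (tval t v) := by
  rw [tval, tval, ← h.realize_num]
  congr 1
  funext x
  rcases x with x | x
  · exact x.elim
  · rfl

/-- The numerals, in an arbitrary context. -/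
def numT {α : Type} : ℕ → LA.Term α
  | 0 => zeroT
  | n + 1 => succT (numT n)

@[simp]
theorem realize_numT (n : ℕ) : (numT n : LA.Term α).realize v = num M n := by
  induction n with
  | zero => exact realize_zeroT v
  | succ n ih => rw [numT, realize_succT, ih, num]

theorem num_nat (n : ℕ) : num ℕ n = n := by
  induction n with
  | zero => rfl
  | succ n ih => exact congrArg (· + 1) ih

theorem sat_sentence (φ : LA.Sentence) (v : Fin 0 → M) : M ⊨ φ ↔ Sat φ v := by
  rw [Subsingleton.elim v default]
  exact Iff.rfl

/-- `Σₙ₊₁`-completeness of Robinson arithmetic with the true `Πₙ`-sentences. -/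
theorem IsQ.sat_of_isSigma (h : IsQ M) {n : ℕ} (hM : M ⊨ PiTh n) {k : ℕ}
    {φ : LA.BoundedFormula Empty k} (hφ : IsSigma (n + 1) φ) (v : Fin k → ℕ) (hv : Sat φ v) :
    Sat φ fun i => num M (v i) := by
  refine (hierarchy_induction (S := fun m k φ => m = n + 1 → ∀ v : Fin k → ℕ, Sat φ v →
      Sat φ fun i => num M (v i))
    (P := fun _ _ _ => True) ?_ ?_ ?_ ?_ ?_ ?_ ?_ ?_ ?_ ?_ ?_ ?_).1 hφ rfl v hv
  · intro k φ _ hm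
    omega
  · rintro m k χ hχ - hm v hv
    obtain rfl : m = n := by omega
    obtain ⟨ψ, h1, h2⟩ := isSigma_isPi_substClosed.2 hχ 0 fun i => numT (v i)
    have h3 : ψ ∈ PiTh m := by
      refine ⟨h1, (sat_sentence ψ default).2 ((h2 ℕ default).2 ?_)⟩
      simpa only [tval, realize_numT, num_nat] using hv
    have h4 := (h2 M default).1 ((sat_sentence ψ default).1 (hM.realize_of_mem ψ h3))
    simpa only [tval, realize_numT] using h4
  · intro m k φ ih hm v hv
    simp only [Sat, realize_ex] at hv ⊢
    obtain ⟨a, ha⟩ := hv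
    refine ⟨num M a, ?_⟩
    convert ih hm _ ha using 1
    funext i
    refine Fin.lastCases ?_ (fun i => ?_) i <;> simp
  · intro m k φ ψ ih₁ ih₂ hm v hv
    simp only [Sat, realize_inf] at hv ⊢
    exact ⟨ih₁ hm _ hv.1, ih₂ hm _ hv.2⟩
  · intro m k φ ψ ih₁ ih₂ hm v hv
    simp only [Sat, realize_sup] at hv ⊢
    exact hv.imp (ih₁ hm _) (ih₂ hm _)
  · intro m k t φ ih hm v hv
    rw [sat_bdall] at hv ⊢
    intro a ha
    rw [h.tval_num, h.leM_num_iff] at ha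
    obtain ⟨j, hj, rfl⟩ := ha
    convert ih hm _ (hv j hj) using 1
    funext i
    refine Fin.lastCases ?_ (fun i => ?_) i <;> simp
  all_goals intros; trivial

end Model

section Codes

open Encodable

/-- The code of a term as a list of numbers. -/
def tcode {k : ℕ} (t : LA.Term (Empty ⊕ Fin k)) : List ℕ := t.listEncode.map encode

/-- The code of a formula as a list of numbers. -/
def fcode {k : ℕ} (φ : LA.BoundedFormula Empty k) : List ℕ := φ.listEncode.map encode

theorem encode_map_encode {α : Type} [Encodable α] (l : List α) :
    encode (l.map encode) = encode l := by
  induction l with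
  | nil => rfl
  | cons a l ih => simp [ih]

theorem godel_eq {k : ℕ} (φ : LA.BoundedFormula Empty k) : godel φ = encode (fcode φ) :=
  (encode_map_encode _).symm

theorem fcode_injective {k l : ℕ} {φ : LA.BoundedFormula Empty k} {ψ : LA.BoundedFormula Empty l}
    (h : fcode φ = fcode ψ) : (⟨k, φ⟩ : Σ k, LA.BoundedFormula Empty k) = ⟨l, ψ⟩ :=
  BoundedFormula.listEncode_sigma_injective (encode_injective.list_map h)

variable {k : ℕ}

theorem tcode_var (i : Fin k) : tcode (&i : LA.Term (Empty ⊕ Fin k)) = [4 * (i : ℕ) + 2] := by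
  change [2 * (2 * (i : ℕ) + 1)] = _
  congr 1
  omega

theorem tcode_zero (ts : Fin 0 → LA.Term (Empty ⊕ Fin k)) :
    tcode (Term.func (ArithFunc.zero : LA.Functions 0) ts) = [1] := by
  simp [tcode, Term.listEncode]
  rfl

theorem tcode_succ (ts : Fin 1 → LA.Term (Empty ⊕ Fin k)) :
    tcode (Term.func (ArithFunc.succ : LA.Functions 1) ts) = 3 :: tcode (ts 0) := by
  simp [tcode, Term.listEncode, List.finRange_succ]
  rfl

theorem tcode_add (ts : Fin 2 → LA.Term (Empty ⊕ Fin k)) :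
    tcode (Term.func (ArithFunc.add : LA.Functions 2) ts) =
      5 :: (tcode (ts 0) ++ tcode (ts 1)) := by
  simp [tcode, Term.listEncode, List.finRange_succ]
  rfl

theorem tcode_mul (ts : Fin 2 → LA.Term (Empty ⊕ Fin k)) :
    tcode (Term.func (ArithFunc.mul : LA.Functions 2) ts) =
      7 :: (tcode (ts 0) ++ tcode (ts 1)) := by
  simp [tcode, Term.listEncode, List.finRange_succ]
  rfl

/-- The token of a term with code `u` in a formula in context `k`. -/
def termToken (k : ℕ) (u : List ℕ) : ℕ := 2 * Nat.pair k (encode u)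

theorem fcode_falsum : fcode (⊥ : LA.BoundedFormula Empty k) = [4 * (k + 2) + 3] := by
  simp [fcode, BoundedFormula.listEncode]
  omega

theorem encode_inl_term (t : LA.Term (Empty ⊕ Fin k)) :
    encode (Sum.inl ⟨k, t⟩ : (Σ k, LA.Term (Empty ⊕ Fin k)) ⊕ ((Σ n, LA.Relations n) ⊕ ℕ)) =
      termToken k (tcode t) := by
  rw [termToken, tcode, encode_map_encode]
  rfl

theorem fcode_equal (t s : LA.Term (Empty ⊕ Fin k)) :
    fcode (BoundedFormula.equal t s) = [termToken k (tcode t), termToken k (tcode s)] := by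
  rw [← encode_inl_term, ← encode_inl_term]
  rfl

theorem fcode_rel (ts : Fin 2 → LA.Term (Empty ⊕ Fin k)) :
    fcode (BoundedFormula.rel (ArithRel.le : LA.Relations 2) ts) =
      [1, 4 * k + 3, termToken k (tcode (ts 0)), termToken k (tcode (ts 1))] := by
  rw [← encode_inl_term, ← encode_inl_term]
  simp [fcode, BoundedFormula.listEncode, List.finRange_succ]
  refine ⟨rfl, by omega⟩

theorem fcode_imp (φ ψ : LA.BoundedFormula Empty k) :
    fcode (φ ⟹ ψ) = 3 :: (fcode φ ++ fcode ψ) := by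
  simp [fcode, BoundedFormula.listEncode]

theorem fcode_all (φ : LA.BoundedFormula Empty (k + 1)) : fcode φ.all = 7 :: fcode φ := by
  simp [fcode, BoundedFormula.listEncode]

end Codes

section Clauses

open Encodable

/-- Propositional atoms: `(tag, code, parameters)`. -/
abbrev Atom := ℕ × List ℕ × List ℕ

/-- A clause `⋀ premises → ⋁ conclusions`. -/
abbrev Clause := List Atom × List Atom

/-- The valuation `W` satisfies the clause `c`. -/
def Holds (W : Atom → Prop) (c : Clause) : Prop := (∀ p ∈ c.1, W p) → ∃ q ∈ c.2, W q

/-- The term coded by `u` takes the value `a` at `v`. -/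
def valA (u v : List ℕ) (a : ℕ) : Atom := (0, u, a :: v)
/-- `u` codes a formula in context `k`. -/
def fmA (k : ℕ) (u : List ℕ) : Atom := (1, u, [k])
/-- The formula coded by `u` is true at `v`. -/
def trA (u v : List ℕ) : Atom := (2, u, v)
/-- The elements `a` and `b` are equal. -/
def eqA (a b : ℕ) : Atom := (3, [], [a, b])
/-- The element `a` is less than or equal to `b`. -/
def leA (a b : ℕ) : Atom := (4, [], [a, b])

/-- The elements of the Henkin model: closed terms with witnesses for the formulas coded by `u`. -/
def el (i : ℕ) (u v : List ℕ) : ℕ := encode (i, u, v)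

/-- The element `0`. -/
def zeroEl : ℕ := el 0 [] []
/-- The element `S a`. -/
def succEl (a : ℕ) : ℕ := el 1 [] [a]
/-- The element `a + b`. -/
def addEl (a b : ℕ) : ℕ := el 2 [] [a, b]
/-- The element `a × b`. -/
def mulEl (a b : ℕ) : ℕ := el 3 [] [a, b]
/-- A counterexample to the formula coded by `u` at `v`, if there is one. -/
def witEl (u v : List ℕ) : ℕ := el 4 u v

/-- The numerals as elements of the Henkin model. -/
def numEl : ℕ → ℕ
  | 0 => zeroEl
  | n + 1 => succEl (numEl n)

/-- The code of falsum. -/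
def falsumCode (k : ℕ) : List ℕ := [4 * (k + 2) + 3]
/-- The code of an equation. -/
def eqCode (k : ℕ) (u u' : List ℕ) : List ℕ := [termToken k u, termToken k u']
/-- The code of an inequality. -/
def leCode (k : ℕ) (u u' : List ℕ) : List ℕ := [1, 4 * k + 3, termToken k u, termToken k u']
/-- The code of a binary operation applied to terms or formulas. -/
def binCode (i : ℕ) (u u' : List ℕ) : List ℕ := i :: (u ++ u')

/-- The parameters of the clauses describing a Henkin model. -/
abbrev Param := (List ℕ × List ℕ) × (List ℕ × List ℕ) × (ℕ × ℕ) × (ℕ × ℕ)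

/-- The clauses describing the values of terms. -/
def valClauses (u u' v v' : List ℕ) (a b : ℕ) : List Clause :=
  [([], [valA [4 * v.length + 2] (v ++ a :: v') a]),
    ([], [valA [1] v zeroEl]),
    ([valA u v a], [valA (3 :: u) v (succEl a)]),
    ([valA u v a, valA u' v b], [valA (binCode 5 u u') v (addEl a b)]),
    ([valA u v a, valA u' v b], [valA (binCode 7 u u') v (mulEl a b)])]

/-- The clauses describing the codes of formulas. -/
def fmClauses (u u' v : List ℕ) (a b : ℕ) : List Clause :=
  [([], [fmA v.length (falsumCode v.length)]),
    ([valA u v a, valA u' v b], [fmA v.length (eqCode v.length u u')]),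
    ([valA u v a, valA u' v b], [fmA v.length (leCode v.length u u')]),
    ([fmA a u, fmA a u'], [fmA a (binCode 3 u u')]),
    ([fmA (a + 1) u], [fmA a (7 :: u)])]

/-- The clauses describing the truth of atomic formulas. -/
def trAtomClauses (u u' v : List ℕ) (a b : ℕ) : List Clause :=
  [([trA (falsumCode v.length) v], []),
    ([valA u v a, valA u' v b, trA (eqCode v.length u u') v], [eqA a b]),
    ([valA u v a, valA u' v b, eqA a b], [trA (eqCode v.length u u') v]),
    ([valA u v a, valA u' v b, trA (leCode v.length u u') v], [leA a b]),
    ([valA u v a, valA u' v b, leA a b], [trA (leCode v.length u u') v])]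

/-- The clauses describing the truth of compound formulas. -/
def trClauses (u u' v : List ℕ) (a : ℕ) : List Clause :=
  [([fmA v.length u, fmA v.length u', trA (binCode 3 u u') v, trA u v], [trA u' v]),
    ([fmA v.length u, fmA v.length u'], [trA u v, trA (binCode 3 u u') v]),
    ([fmA v.length u, fmA v.length u', trA u' v], [trA (binCode 3 u u') v]),
    ([fmA (v.length + 1) u, trA (7 :: u) v], [trA u (v ++ [a])]),
    ([fmA (v.length + 1) u, trA u (v ++ [witEl u v])], [trA (7 :: u) v])]

/-- The clauses stating that equality is a congruence. -/
def eqClauses (a b c d : ℕ) : List Clause :=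
  [([], [eqA a a]),
    ([eqA a b], [eqA b a]),
    ([eqA a b, eqA b c], [eqA a c]),
    ([eqA a b], [eqA (succEl a) (succEl b)]),
    ([eqA a b, eqA c d], [eqA (addEl a c) (addEl b d)]),
    ([eqA a b, eqA c d], [eqA (mulEl a c) (mulEl b d)]),
    ([eqA a b, eqA c d, leA a c], [leA b d])]

/-- All clauses describing a Henkin model. -/
def henkinClauses (p : Param) : List Clause :=
  valClauses p.1.1 p.1.2 p.2.1.1 p.2.1.2 p.2.2.1.1 p.2.2.1.2 ++
    (fmClauses p.1.1 p.1.2 p.2.1.1 p.2.2.1.1 p.2.2.1.2 ++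
    (trAtomClauses p.1.1 p.1.2 p.2.1.1 p.2.2.1.1 p.2.2.1.2 ++
    (trClauses p.1.1 p.1.2 p.2.1.1 p.2.2.1.1 ++
    eqClauses p.2.2.1.1 p.2.2.1.2 p.2.2.2.1 p.2.2.2.2)))

/-- `W` satisfies the clauses describing a Henkin model. -/
structure IsHenkin (W : Atom → Prop) : Prop where
  val (u u' v v' : List ℕ) (a b : ℕ) : ∀ c ∈ valClauses u u' v v' a b, Holds W c
  fm (u u' v : List ℕ) (a b : ℕ) : ∀ c ∈ fmClauses u u' v a b, Holds W c
  trAtom (u u' v : List ℕ) (a b : ℕ) : ∀ c ∈ trAtomClauses u u' v a b, Holds W c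
  tr (u u' v : List ℕ) (a : ℕ) : ∀ c ∈ trClauses u u' v a, Holds W c
  eq (a b c d : ℕ) : ∀ x ∈ eqClauses a b c d, Holds W x

theorem isHenkin_iff (W : Atom → Prop) :
    IsHenkin W ↔ ∀ p, ∀ c ∈ henkinClauses p, Holds W c := by
  simp only [henkinClauses, List.mem_append]
  constructor
  · rintro ⟨h1, h2, h3, h4, h5⟩ p c (h | h | h | h | h)
    exacts [h1 _ _ _ _ _ _ c h, h2 _ _ _ _ _ c h, h3 _ _ _ _ _ c h, h4 _ _ _ _ c h,
      h5 _ _ _ _ c h]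
  · intro h
    exact ⟨fun u u' v v' a b c hc => h ((u, u'), (v, v'), (a, b), (0, 0)) c (.inl hc),
      fun u u' v a b c hc => h ((u, u'), (v, []), (a, b), (0, 0)) c (.inr (.inl hc)),
      fun u u' v a b c hc => h ((u, u'), (v, []), (a, b), (0, 0)) c (.inr (.inr (.inl hc))),
      fun u u' v a c hc => h ((u, u'), (v, []), (a, 0), (0, 0)) c (.inr (.inr (.inr (.inl hc)))),
      fun a b x d c hc => h (([], []), ([], []), (a, b), (x, d)) c
        (.inr (.inr (.inr (.inr hc))))⟩

end Clauses

section Completeness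

variable {W : Atom → Prop}

theorem valClauses_iff (u u' v v' : List ℕ) (a b : ℕ) :
    (∀ x ∈ valClauses u u' v v' a b, Holds W x) ↔
    W (valA [4 * v.length + 2] (v ++ a :: v') a) ∧
    W (valA [1] v zeroEl) ∧
    (W (valA u v a) → W (valA (3 :: u) v (succEl a))) ∧
    (W (valA u v a) → W (valA u' v b) → W (valA (binCode 5 u u') v (addEl a b))) ∧
    (W (valA u v a) → W (valA u' v b) → W (valA (binCode 7 u u') v (mulEl a b))) := by
  simp [valClauses, Holds, -Prod.forall, -Prod.exists]

theorem fmClauses_iff (u u' v : List ℕ) (a b : ℕ) :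
    (∀ x ∈ fmClauses u u' v a b, Holds W x) ↔
    W (fmA v.length (falsumCode v.length)) ∧
    (W (valA u v a) → W (valA u' v b) → W (fmA v.length (eqCode v.length u u'))) ∧
    (W (valA u v a) → W (valA u' v b) → W (fmA v.length (leCode v.length u u'))) ∧
    (W (fmA a u) → W (fmA a u') → W (fmA a (binCode 3 u u'))) ∧
    (W (fmA (a + 1) u) → W (fmA a (7 :: u))) := by
  simp [fmClauses, Holds, -Prod.forall, -Prod.exists]

theorem trAtomClauses_iff (u u' v : List ℕ) (a b : ℕ) :
    (∀ x ∈ trAtomClauses u u' v a b, Holds W x) ↔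
    ¬ W (trA (falsumCode v.length) v) ∧
    (W (valA u v a) → W (valA u' v b) → W (trA (eqCode v.length u u') v) → W (eqA a b)) ∧
    (W (valA u v a) → W (valA u' v b) → W (eqA a b) → W (trA (eqCode v.length u u') v)) ∧
    (W (valA u v a) → W (valA u' v b) → W (trA (leCode v.length u u') v) → W (leA a b)) ∧
    (W (valA u v a) → W (valA u' v b) → W (leA a b) → W (trA (leCode v.length u u') v)) := by
  simp [trAtomClauses, Holds, -Prod.forall, -Prod.exists]

theorem trClauses_iff (u u' v : List ℕ) (a : ℕ) :
    (∀ x ∈ trClauses u u' v a, Holds W x) ↔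
    (W (fmA v.length u) → W (fmA v.length u') → W (trA (binCode 3 u u') v) → W (trA u v) →
      W (trA u' v)) ∧
    (W (fmA v.length u) → W (fmA v.length u') → W (trA u v) ∨ W (trA (binCode 3 u u') v)) ∧
    (W (fmA v.length u) → W (fmA v.length u') → W (trA u' v) → W (trA (binCode 3 u u') v)) ∧
    (W (fmA (v.length + 1) u) → W (trA (7 :: u) v) → W (trA u (v ++ [a]))) ∧
    (W (fmA (v.length + 1) u) → W (trA u (v ++ [witEl u v])) → W (trA (7 :: u) v)) := by
  simp [trClauses, Holds, -Prod.forall, -Prod.exists]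

theorem eqClauses_iff (a b c d : ℕ) :
    (∀ x ∈ eqClauses a b c d, Holds W x) ↔
    W (eqA a a) ∧
    (W (eqA a b) → W (eqA b a)) ∧
    (W (eqA a b) → W (eqA b c) → W (eqA a c)) ∧
    (W (eqA a b) → W (eqA (succEl a) (succEl b))) ∧
    (W (eqA a b) → W (eqA c d) → W (eqA (addEl a c) (addEl b d))) ∧
    (W (eqA a b) → W (eqA c d) → W (eqA (mulEl a c) (mulEl b d))) ∧
    (W (eqA a b) → W (eqA c d) → W (leA a c) → W (leA b d)) := by
  simp [eqClauses, Holds, -Prod.forall, -Prod.exists]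

end Completeness

section Completeness

variable {W : Atom → Prop}

/-- The equality of elements of the Henkin model. -/
def IsHenkin.setoid (h : IsHenkin W) : Setoid ℕ where
  r a b := W (eqA a b)
  iseqv :=
    { refl a := ((eqClauses_iff a a a a).1 (h.eq _ _ _ _)).1
      symm {a b} := ((eqClauses_iff a b a a).1 (h.eq _ _ _ _)).2.1
      trans {a b c} := ((eqClauses_iff a b c a).1 (h.eq _ _ _ _)).2.2.1 }

/-- The Henkin model described by the valuation `W`. -/
def IsHenkin.Model (h : IsHenkin W) : Type := Quotient h.setoid

/-- The element of the Henkin model named by `a`. -/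
def IsHenkin.elem (h : IsHenkin W) (a : ℕ) : h.Model := Quotient.mk h.setoid a

instance (h : IsHenkin W) : LA.Structure h.Model where
  funMap {_} f := match f with
    | ArithFunc.zero => fun _ => h.elem zeroEl
    | ArithFunc.succ => fun v => Quotient.map succEl
        (fun a b => ((eqClauses_iff a b a a).1 (h.eq _ _ _ _)).2.2.2.1) (v 0)
    | ArithFunc.add => fun v => Quotient.map₂ addEl
        (fun a b hab c d => ((eqClauses_iff a b c d).1 (h.eq _ _ _ _)).2.2.2.2.1 hab) (v 0) (v 1)
    | ArithFunc.mul => fun v => Quotient.map₂ mulEl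
        (fun a b hab c d => ((eqClauses_iff a b c d).1 (h.eq _ _ _ _)).2.2.2.2.2.1 hab) (v 0) (v 1)
  RelMap {_} r := match r with
    | ArithRel.le => fun v => Quotient.lift₂ (fun a b => W (leA a b))
        (fun a c b d hab hcd => propext
          ⟨((eqClauses_iff a b c d).1 (h.eq _ _ _ _)).2.2.2.2.2.2 hab hcd,
            ((eqClauses_iff b a d c).1 (h.eq _ _ _ _)).2.2.2.2.2.2
              (h.setoid.symm hab) (h.setoid.symm hcd)⟩) (v 0) (v 1)

variable (h : IsHenkin W)

theorem IsHenkin.elem_eq_elem (a b : ℕ) : h.elem a = h.elem b ↔ W (eqA a b) :=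
  Quotient.eq (r := h.setoid)

theorem IsHenkin.num_eq (n : ℕ) : num h.Model n = h.elem (numEl n) := by
  induction n with
  | zero => rfl
  | succ n ih => rw [num, ih]; rfl

/-- The environment given by a list of elements. -/
def IsHenkin.env (v : List ℕ) (i : ℕ) : h.Model := h.elem (v.getD i 0)

theorem IsHenkin.exists_val {k : ℕ} (t : LA.Term (Empty ⊕ Fin k)) (v : List ℕ)
    (hv : v.length = k) :
    ∃ a, W (valA (tcode t) v a) ∧ tval t (fun i => h.env v i) = h.elem a := by
  induction t with
  | var i =>
    rcases i with i | i
    · exact i.elim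
    · refine ⟨v.getD i 0, ?_, rfl⟩
      have hi : (i : ℕ) < v.length := hv ▸ i.2
      have := ((valClauses_iff [] [] (v.take i) (v.drop (i + 1)) v[(i : ℕ)] 0).1
        (h.val _ _ _ _ _ _)).1
      have h2 : v.take i ++ v[(i : ℕ)] :: v.drop (i + 1) = v := by simp
      rw [h2, List.length_take, min_eq_left hi.le] at this
      refine Eq.subst ?_ this
      rw [List.getD_eq_getElem _ _ hi]
      exact congrArg (fun u => valA u v _) (tcode_var i).symm
  | @func l f ts ih =>
    choose a ha ha' using ih
    cases f with
    | zero =>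
      exact ⟨zeroEl, by
        rw [tcode_zero]; exact ((valClauses_iff [] [] v [] 0 0).1 (h.val _ _ _ _ _ _)).2.1, rfl⟩
    | succ =>
      refine ⟨succEl (a 0), ?_, ?_⟩
      · rw [tcode_succ]
        exact ((valClauses_iff _ [] v [] _ 0).1 (h.val _ _ _ _ _ _)).2.2.1 (ha 0)
      · refine (congrArg (Structure.funMap _) (funext ha')).trans rfl
    | add =>
      refine ⟨addEl (a 0) (a 1), ?_, ?_⟩
      · rw [tcode_add]
        exact ((valClauses_iff _ _ v [] _ _).1 (h.val _ _ _ _ _ _)).2.2.2.1 (ha 0) (ha 1)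
      · refine (congrArg (Structure.funMap _) (funext ha')).trans rfl
    | mul =>
      refine ⟨mulEl (a 0) (a 1), ?_, ?_⟩
      · rw [tcode_mul]
        exact ((valClauses_iff _ _ v [] _ _).1 (h.val _ _ _ _ _ _)).2.2.2.2 (ha 0) (ha 1)
      · refine (congrArg (Structure.funMap _) (funext ha')).trans rfl

theorem IsHenkin.env_snoc {k : ℕ} (v : List ℕ) (hv : v.length = k) (a : ℕ) :
    (fun i : Fin (k + 1) => h.env (v ++ [a]) i) =
      (Fin.snoc (fun i : Fin k => h.env v i) (h.elem a) : Fin (k + 1) → h.Model) := by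
  subst hv
  funext i
  refine Fin.lastCases ?_ (fun i => ?_) i
  · simp [IsHenkin.env]
  · simp [IsHenkin.env]

theorem IsHenkin.tr_iff {k : ℕ} (φ : LA.BoundedFormula Empty k) :
    W (fmA k (fcode φ)) ∧ ∀ v : List ℕ, v.length = k →
      (W (trA (fcode φ) v) ↔ Sat φ fun i => h.env v i) := by
  induction φ with
  | @falsum k =>
    have hc : fcode (BoundedFormula.falsum : LA.BoundedFormula Empty k) = falsumCode k :=
      fcode_falsum
    rw [hc]
    refine ⟨?_, ?_⟩
    · have := ((fmClauses_iff [] [] (.replicate k 0) 0 0).1 (h.fm _ _ _ _ _)).1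
      rwa [List.length_replicate] at this
    · rintro v rfl
      exact iff_of_false ((trAtomClauses_iff [] [] v 0 0).1 (h.trAtom _ _ _ _ _)).1 id
  | @equal k t s =>
    have hc : fcode (BoundedFormula.equal t s) = eqCode k (tcode t) (tcode s) := fcode_equal _ _
    rw [hc]
    refine ⟨?_, ?_⟩
    · obtain ⟨a, ha, -⟩ := h.exists_val t (.replicate k 0) (by simp)
      obtain ⟨b, hb, -⟩ := h.exists_val s (.replicate k 0) (by simp)
      have := ((fmClauses_iff _ _ (.replicate k 0) _ _).1 (h.fm _ _ _ _ _)).2.1 ha hb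
      rwa [List.length_replicate] at this
    · rintro v rfl
      obtain ⟨a, ha, ha'⟩ := h.exists_val t v rfl
      obtain ⟨b, hb, hb'⟩ := h.exists_val s v rfl
      obtain ⟨-, h1, h2, -⟩ := (trAtomClauses_iff _ _ v _ _).1 (h.trAtom (tcode t) (tcode s) v a b)
      refine Iff.trans ⟨h1 ha hb, h2 ha hb⟩ ?_
      rw [← h.elem_eq_elem, ← ha', ← hb']
      exact Iff.rfl
  | @rel k l r ts =>
    cases r
    have hc : fcode (BoundedFormula.rel (ArithRel.le : LA.Relations 2) ts) =
      leCode k (tcode (ts 0)) (tcode (ts 1)) := fcode_rel _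
    rw [hc]
    refine ⟨?_, ?_⟩
    · obtain ⟨a, ha, -⟩ := h.exists_val (ts 0) (.replicate k 0) (by simp)
      obtain ⟨b, hb, -⟩ := h.exists_val (ts 1) (.replicate k 0) (by simp)
      have := ((fmClauses_iff _ _ (.replicate k 0) _ _).1 (h.fm _ _ _ _ _)).2.2.1 ha hb
      rwa [List.length_replicate] at this
    · rintro v rfl
      obtain ⟨a, ha, ha'⟩ := h.exists_val (ts 0) v rfl
      obtain ⟨b, hb, hb'⟩ := h.exists_val (ts 1) v rfl
      obtain ⟨-, -, -, h1, h2⟩ := (trAtomClauses_iff _ _ v _ _).1 (h.trAtom _ _ v a b)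
      refine Iff.trans ⟨h1 ha hb, h2 ha hb⟩ ?_
      change leM (h.elem a) (h.elem b) ↔
        leM (tval (ts 0) fun i => h.env v i) (tval (ts 1) fun i => h.env v i)
      rw [ha', hb']
  | @imp k φ ψ ih₁ ih₂ =>
    have hc : fcode (φ ⟹ ψ) = binCode 3 (fcode φ) (fcode ψ) := fcode_imp _ _
    rw [hc]
    refine ⟨?_, ?_⟩
    · exact ((fmClauses_iff _ _ [] _ 0).1 (h.fm _ _ _ _ _)).2.2.2.1 ih₁.1 ih₂.1
    · rintro v rfl
      obtain ⟨h1, h2, h3, -⟩ := (trClauses_iff _ _ v 0).1 (h.tr (fcode φ) (fcode ψ) v 0)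
      have e1 := ih₁.2 v rfl
      have e2 := ih₂.2 v rfl
      simp only [Sat, realize_imp] at e1 e2 ⊢
      rw [← e1, ← e2]
      refine ⟨h1 ih₁.1 ih₂.1, fun himp => ?_⟩
      exact (h2 ih₁.1 ih₂.1).elim (fun h4 => h3 ih₁.1 ih₂.1 (himp h4)) id
  | @all k φ ih =>
    rw [fcode_all]
    refine ⟨?_, ?_⟩
    · exact ((fmClauses_iff _ [] [] _ 0).1 (h.fm _ _ _ _ _)).2.2.2.2 ih.1
    · rintro v rfl
      have e (a : ℕ) := ih.2 (v ++ [a]) (by simp)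
      have hr (a : ℕ) := ((trClauses_iff _ _ v a).1 (h.tr (fcode φ) [] v a)).2.2.2
      simp only [h.env_snoc v rfl] at e
      simp only [Sat, realize_all] at e ⊢
      constructor
      · intro htr x
        obtain ⟨a, rfl⟩ := Quotient.exists_rep x
        exact (e a).1 ((hr a).1 ih.1 htr)
      · intro hall
        exact (hr 0).2 ih.1 ((e _).2 (hall _))

end Completeness

section Soundness

open Encodable

theorem lt_encode_of_mem {l : List ℕ} {a : ℕ} (h : a ∈ l) : a < encode l := by
  induction l with
  | nil => simp at h
  | cons b l ih =>
    rw [encode_list_cons, Nat.lt_succ_iff]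
    rcases List.mem_cons.1 h with rfl | h
    · exact Nat.left_le_pair _ _
    · exact (ih h).le.trans (Nat.right_le_pair _ _)

theorem lt_el_of_mem {i : ℕ} {u v : List ℕ} {a : ℕ} (h : a ∈ v) : a < el i u v :=
  (lt_encode_of_mem h).trans_le ((Nat.right_le_pair _ _).trans (Nat.right_le_pair _ _))

variable (M : Type) [LA.Structure M]

open scoped Classical in
/-- The interpretation of an element of the Henkin model in terms of its components. -/
noncomputable def interpStep (g : ℕ → M) (p : Atom) : M :=
  if p.1 = 1 then succM (g (p.2.2.getD 0 0))
  else if p.1 = 2 then addM (g (p.2.2.getD 0 0)) (g (p.2.2.getD 1 0))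
  else if p.1 = 3 then mulM (g (p.2.2.getD 0 0)) (g (p.2.2.getD 1 0))
  else if h : p.1 = 4 ∧ ∃ a : M, ∃ φ : LA.BoundedFormula Empty (p.2.2.length + 1),
    fcode φ = p.2.1 ∧ ¬ Sat φ (Fin.snoc (fun i => g (p.2.2.get i)) a :
      Fin (p.2.2.length + 1) → M) then h.2.choose
  else zeroM

/-- The interpretation of the elements of the Henkin model in the structure `M`. -/
noncomputable def interp (n : ℕ) : M :=
  interpStep M (fun m => if m < n then interp m else zeroM) (Denumerable.ofNat Atom n)

theorem interp_el (i : ℕ) (u v : List ℕ) :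
    interp M (el i u v) =
      interpStep M (fun m => if m < el i u v then interp M m else zeroM) (i, u, v) := by
  rw [interp, el, Denumerable.ofNat_encode]

theorem interp_zeroEl : interp M zeroEl = zeroM := by
  rw [zeroEl, interp_el]
  simp [interpStep]

theorem interp_succEl (a : ℕ) : interp M (succEl a) = succM (interp M a) := by
  rw [succEl, interp_el]
  simp [interpStep, lt_el_of_mem]

theorem interp_addEl (a b : ℕ) : interp M (addEl a b) = addM (interp M a) (interp M b) := by
  rw [addEl, interp_el]
  simp [interpStep, lt_el_of_mem]

theorem interp_mulEl (a b : ℕ) : interp M (mulEl a b) = mulM (interp M a) (interp M b) := by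
  rw [mulEl, interp_el]
  simp [interpStep, lt_el_of_mem]

theorem interp_numEl (n : ℕ) : interp M (numEl n) = num M n := by
  induction n with
  | zero => exact interp_zeroEl M
  | succ n ih => rw [numEl, interp_succEl, ih, num]

/-- The environment in `M` given by a list of elements of the Henkin model. -/
noncomputable def interpEnv (v : List ℕ) (i : ℕ) : M := interp M (v.getD i 0)

variable {M}

theorem interpEnv_snoc {k : ℕ} (v : List ℕ) (hv : v.length = k) (a : ℕ) :
    (fun i : Fin (k + 1) => interpEnv M (v ++ [a]) i) =
      (Fin.snoc (fun i : Fin k => interpEnv M v i) (interp M a) : Fin (k + 1) → M) := by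
  subst hv
  funext i
  refine Fin.lastCases ?_ (fun i => ?_) i <;> simp [interpEnv]

theorem sat_witEl (v : List ℕ) (φ : LA.BoundedFormula Empty (v.length + 1))
    (h : Sat φ (Fin.snoc (fun i : Fin v.length => interpEnv M v i)
      (interp M (witEl (fcode φ) v)) : Fin (v.length + 1) → M)) (a : M) :
    Sat φ (Fin.snoc (fun i : Fin v.length => interpEnv M v i) a : Fin (v.length + 1) → M) := by
  by_contra ha
  have he : (fun i => if v.get i < el 4 (fcode φ) v then interp M (v.get i) else zeroM) =
      fun i : Fin v.length => interpEnv M v i := by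
    funext i
    rw [if_pos (lt_el_of_mem (List.get_mem _ _))]
    simp [interpEnv]
  have hex : ∃ a : M, ∃ ψ : LA.BoundedFormula Empty (v.length + 1), fcode ψ = fcode φ ∧
      ¬ Sat ψ (Fin.snoc (fun i => if v.get i < el 4 (fcode φ) v then interp M (v.get i)
        else zeroM) a : Fin (v.length + 1) → M) := ⟨a, φ, rfl, by rwa [he]⟩
  have hw : interp M (witEl (fcode φ) v) = hex.choose := by
    rw [witEl, interp_el, interpStep, if_neg (by simp), if_neg (by simp), if_neg (by simp),
      dif_pos ⟨rfl, hex⟩]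
  obtain ⟨ψ, h1, h2⟩ := hex.choose_spec
  obtain rfl : ψ = φ := by simpa using fcode_injective h1
  rw [← hw, he] at h2
  exact h2 h

variable (M)

/-- The valuation describing the structure `M`. -/
def modelVal : Atom → Prop
  | (0, u, a :: v) => ∃ t : LA.Term (Empty ⊕ Fin v.length), tcode t = u ∧
      tval t (fun i => interpEnv M v i) = interp M a
  | (1, u, [k]) => ∃ φ : LA.BoundedFormula Empty k, fcode φ = u
  | (2, u, v) => ∃ φ : LA.BoundedFormula Empty v.length, fcode φ = u ∧
      Sat φ fun i => interpEnv M v i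
  | (3, _, [a, b]) => interp M a = interp M b
  | (4, _, [a, b]) => leM (interp M a) (interp M b)
  | _ => False

theorem modelVal_valA (u v : List ℕ) (a : ℕ) : modelVal M (valA u v a) ↔
    ∃ t : LA.Term (Empty ⊕ Fin v.length), tcode t = u ∧
      tval t (fun i => interpEnv M v i) = interp M a := by
  rw [valA, modelVal]

theorem modelVal_fmA (k : ℕ) (u : List ℕ) :
    modelVal M (fmA k u) ↔ ∃ φ : LA.BoundedFormula Empty k, fcode φ = u := by
  rw [fmA, modelVal]

theorem modelVal_trA (u v : List ℕ) : modelVal M (trA u v) ↔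
    ∃ φ : LA.BoundedFormula Empty v.length, fcode φ = u ∧ Sat φ fun i => interpEnv M v i := by
  rw [trA, modelVal]

theorem modelVal_eqA (a b : ℕ) : modelVal M (eqA a b) ↔ interp M a = interp M b := by
  rw [eqA, modelVal]

theorem modelVal_leA (a b : ℕ) : modelVal M (leA a b) ↔ leM (interp M a) (interp M b) := by
  rw [leA, modelVal]

theorem modelVal_trA_fcode {k : ℕ} (φ : LA.BoundedFormula Empty k) (v : List ℕ)
    (hv : v.length = k) : modelVal M (trA (fcode φ) v) ↔ Sat φ fun i => interpEnv M v i := by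
  subst hv
  rw [modelVal_trA]
  refine ⟨fun ⟨ψ, h1, h2⟩ => ?_, fun h => ⟨φ, rfl, h⟩⟩
  obtain rfl : ψ = φ := by simpa using fcode_injective h1
  exact h2

theorem isHenkin_modelVal : IsHenkin (modelVal M) := by
  constructor
  · intro u u' v v' a b
    rw [valClauses_iff]
    refine ⟨?_, ?_, fun h => ?_, fun h h' => ?_, fun h h' => ?_⟩
    · rw [modelVal_valA]
      exact ⟨&⟨v.length, by simp⟩, tcode_var _, by simp [interpEnv]⟩
    · rw [modelVal_valA]
      exact ⟨zeroT, tcode_zero _, by rw [tval, realize_zeroT, interp_zeroEl]⟩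
    · rw [modelVal_valA] at h ⊢
      obtain ⟨t, rfl, ht⟩ := h
      exact ⟨succT t, tcode_succ _, by rw [tval, realize_succT, interp_succEl, ← ht]⟩
    · rw [modelVal_valA] at h h' ⊢
      obtain ⟨t, rfl, ht⟩ := h
      obtain ⟨s, rfl, hs⟩ := h'
      exact ⟨addT t s, tcode_add _, by rw [tval, realize_addT, interp_addEl, ← ht, ← hs]⟩
    · rw [modelVal_valA] at h h' ⊢
      obtain ⟨t, rfl, ht⟩ := h
      obtain ⟨s, rfl, hs⟩ := h'
      exact ⟨mulT t s, tcode_mul _, by rw [tval, realize_mulT, interp_mulEl, ← ht, ← hs]⟩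
  · intro u u' v a b
    rw [fmClauses_iff]
    simp only [modelVal_fmA, modelVal_valA]
    refine ⟨⟨⊥, fcode_falsum⟩, ?_, ?_, ?_, ?_⟩
    · rintro ⟨t, rfl, -⟩ ⟨s, rfl, -⟩
      exact ⟨_, fcode_equal t s⟩
    · rintro ⟨t, rfl, -⟩ ⟨s, rfl, -⟩
      exact ⟨_, fcode_rel ![t, s]⟩
    · rintro ⟨φ, rfl⟩ ⟨ψ, rfl⟩
      exact ⟨_, fcode_imp φ ψ⟩
    · rintro ⟨φ, rfl⟩
      exact ⟨_, fcode_all φ⟩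
  · intro u u' v a b
    rw [trAtomClauses_iff]
    have heq (t s : LA.Term (Empty ⊕ Fin v.length)) :
        eqCode v.length (tcode t) (tcode s) = fcode (BoundedFormula.equal t s) :=
      (fcode_equal t s).symm
    have hle (t s : LA.Term (Empty ⊕ Fin v.length)) :
        leCode v.length (tcode t) (tcode s) = fcode (leF t s) := (fcode_rel ![t, s]).symm
    have hbot : falsumCode v.length = fcode (⊥ : LA.BoundedFormula Empty v.length) :=
      fcode_falsum.symm
    simp only [modelVal_valA]
    refine ⟨?_, ?_, ?_, ?_, ?_⟩
    · rw [hbot, modelVal_trA_fcode _ _ _ rfl]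
      exact id
    · rintro ⟨t, rfl, ht⟩ ⟨s, rfl, hs⟩
      rw [heq, modelVal_trA_fcode _ _ _ rfl, modelVal_eqA, ← ht, ← hs]
      exact id
    · rintro ⟨t, rfl, ht⟩ ⟨s, rfl, hs⟩
      rw [heq, modelVal_trA_fcode _ _ _ rfl, modelVal_eqA, ← ht, ← hs]
      exact id
    · rintro ⟨t, rfl, ht⟩ ⟨s, rfl, hs⟩
      rw [hle, modelVal_trA_fcode _ _ _ rfl, modelVal_leA, sat_leF, ht, hs]
      exact id
    · rintro ⟨t, rfl, ht⟩ ⟨s, rfl, hs⟩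
      rw [hle, modelVal_trA_fcode _ _ _ rfl, modelVal_leA, sat_leF, ht, hs]
      exact id
  · intro u u' v a
    rw [trClauses_iff]
    simp only [modelVal_fmA]
    refine ⟨?_, ?_, ?_, ?_, ?_⟩
    · rintro ⟨φ, rfl⟩ ⟨ψ, rfl⟩
      rw [binCode, ← fcode_imp]
      simp only [modelVal_trA_fcode _ _ _ rfl]
      exact id
    · rintro ⟨φ, rfl⟩ ⟨ψ, rfl⟩
      rw [binCode, ← fcode_imp]
      simp only [modelVal_trA_fcode _ _ _ rfl, Sat, realize_imp]
      tauto
    · rintro ⟨φ, rfl⟩ ⟨ψ, rfl⟩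
      rw [binCode, ← fcode_imp]
      simp only [modelVal_trA_fcode _ _ _ rfl, Sat, realize_imp]
      tauto
    · rintro ⟨φ, rfl⟩
      rw [← fcode_all, modelVal_trA_fcode _ _ _ rfl, modelVal_trA_fcode _ φ _ (by simp),
        interpEnv_snoc v rfl, Sat, realize_all]
      exact fun h => h _
    · rintro ⟨φ, rfl⟩
      rw [← fcode_all, modelVal_trA_fcode _ _ _ rfl, modelVal_trA_fcode _ φ _ (by simp),
        interpEnv_snoc v rfl]
      exact fun h => realize_all.2 (sat_witEl v φ h)
  · intro a b c d
    rw [eqClauses_iff]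
    simp only [modelVal_eqA, modelVal_leA, interp_succEl, interp_addEl, interp_mulEl]
    refine ⟨trivial, Eq.symm, Eq.trans, fun h => by rw [h], fun h h' => by rw [h, h'],
      fun h h' => by rw [h, h'], fun h h' => by rw [h, h']; exact id⟩

end Soundness

section Refutation

open Encodable

theorem isClosed_setOf_holds (c : Clause) :
    IsClosed {W : Atom → Bool | Holds (fun p => W p = true) c} := by
  refine isClosed_imp (p := fun W : Atom → Bool => ∀ p ∈ c.1, W p = true)
    (q := fun W : Atom → Bool => ∃ q ∈ c.2, W q = true) ?_ ?_
  · have := c.1.finite_toSet.isOpen_biInter (f := fun p => {W : Atom → Bool | W p = true})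
      fun p _ => (isOpen_discrete {true}).preimage (f := fun W : Atom → Bool => W p)
        (continuous_apply p)
    convert this using 1
    ext W
    simp
  · have := c.2.finite_toSet.isClosed_biUnion (f := fun p => {W : Atom → Bool | W p = true})
      fun p _ => (isClosed_discrete {true}).preimage (f := fun W : Atom → Bool => W p)
        (continuous_apply p)
    convert this using 1
    ext W
    simp

theorem exists_forall_holds (C : Set Clause)
    (h : ∀ l : List Clause, (∀ c ∈ l, c ∈ C) → ∃ W : Atom → Prop, ∀ c ∈ l, Holds W c) :
    ∃ W : Atom → Prop, ∀ c ∈ C, Holds W c := by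
  classical
  obtain ⟨W, -, hW⟩ := isCompact_univ.inter_iInter_nonempty
    (fun c : C => {W : Atom → Bool | Holds (fun p => W p = true) c})
    (fun c => isClosed_setOf_holds c) fun s => by
      obtain ⟨W, hW⟩ := h (s.toList.map (↑)) fun c hc => by
        obtain ⟨d, -, rfl⟩ := List.mem_map.1 hc
        exact d.2
      refine ⟨fun p => decide (W p), trivial, ?_⟩
      simpa using hW
  exact ⟨fun p => W p = true, fun c hc => Set.mem_iInter.1 hW ⟨c, hc⟩⟩

/-- No valuation satisfies all clauses of the list. -/
def Unsat (l : List Clause) : Prop := ¬ ∃ W : Atom → Prop, ∀ c ∈ l, Holds W c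

/-- All sublists of a list. -/
def subs (l : List Atom) : List (List Atom) :=
  l.foldr (fun a acc => acc ++ acc.map (a :: ·)) [.nil]

theorem filter_mem_subs (P : Atom → Bool) (l : List Atom) : l.filter P ∈ subs l := by
  induction l with
  | nil => simp [subs]
  | cons a l ih =>
    simp only [subs, List.foldr_cons, List.mem_append, List.mem_map] at ih ⊢
    rw [List.filter_cons]
    split
    · exact .inr ⟨_, ih, rfl⟩
    · exact .inl ih

/-- The atoms occurring in a list of clauses. -/
def atoms (l : List Clause) : List Atom := l.flatMap fun c => c.1 ++ c.2

theorem unsat_iff (l : List Clause) :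
    Unsat l ↔ ∀ s ∈ subs (atoms l), ∃ c ∈ l, (∀ p ∈ c.1, p ∈ s) ∧ ∀ q ∈ c.2, q ∉ s := by
  classical
  constructor
  · intro h s _
    by_contra! hs
    exact h ⟨(· ∈ s), hs⟩
  · rintro h ⟨W, hW⟩
    obtain ⟨c, hc, h1, h2⟩ := h _ (filter_mem_subs (fun p => decide (W p)) (atoms l))
    obtain ⟨q, hq, hq'⟩ := hW c hc fun p hp => by simpa using (List.mem_filter.1 (h1 p hp)).2
    refine h2 q hq (List.mem_filter.2 ⟨List.mem_flatMap.2 ⟨c, hc, ?_⟩, by simpa using hq'⟩)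
    exact List.mem_append_right _ hq

/-- The clause stating that the sentence with Gödel number `u` holds. -/
def axClause (u : ℕ) : Clause := ([], [trA (Denumerable.ofNat (List ℕ) u) [] ])

/-- The clause stating that the formula with Gödel number `x` holds at the numeral of `x`, or fails
there, depending on `b`. -/
def goalClause (b : Bool) (x : ℕ) : Clause :=
  bif b then ([], [trA (Denumerable.ofNat (List ℕ) x) [numEl x] ])
  else ([trA (Denumerable.ofNat (List ℕ) x) [numEl x] ], [])

/-- The clauses used in a refutation. -/
def proofClauses (y : List Param × List ℕ) : List Clause :=
  y.1.flatMap henkinClauses ++ y.2.map axClause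

theorem not_exists_isHenkin_iff (A : Set ℕ) (g : Clause) :
    (¬ ∃ W, IsHenkin W ∧ (∀ u ∈ A, Holds W (axClause u)) ∧ Holds W g) ↔
      ∃ y : List Param × List ℕ, (∀ u ∈ y.2, u ∈ A) ∧ Unsat (g :: proofClauses y) := by
  constructor
  · intro h
    by_contra! hy
    apply h
    let C : Set Clause := {c | (∃ p, c ∈ henkinClauses p) ∨ (∃ u ∈ A, axClause u = c) ∨ c = g}
    have key (l : List Clause) (hl : ∀ c ∈ l, c ∈ C) : ∃ y : List Param × List ℕ,
        (∀ u ∈ y.2, u ∈ A) ∧ ∀ c ∈ l, c ∈ g :: proofClauses y := by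
      induction l with
      | nil => exact ⟨([], []), by simp⟩
      | cons c l ih =>
        obtain ⟨y, hy1, hy2⟩ := ih fun c hc => hl c (List.mem_cons_of_mem _ hc)
        simp only [proofClauses, List.mem_cons, List.mem_append, List.mem_flatMap,
          List.mem_map] at hy2
        rcases hl c List.mem_cons_self with ⟨p, hp⟩ | ⟨u, hu, rfl⟩ | rfl
        · refine ⟨(p :: y.1, y.2), hy1, ?_⟩
          simp only [proofClauses, List.mem_cons, List.mem_append, List.mem_flatMap, List.mem_map]
          grind
        · refine ⟨(y.1, u :: y.2), by simpa using ⟨hu, hy1⟩, ?_⟩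
          simp only [proofClauses, List.mem_cons, List.mem_append, List.mem_flatMap, List.mem_map]
          grind
        · refine ⟨y, hy1, ?_⟩
          simp only [proofClauses, List.mem_cons, List.mem_append, List.mem_flatMap, List.mem_map]
          grind
    obtain ⟨W, hW⟩ := exists_forall_holds C fun l hl => by
      obtain ⟨y, hy1, hy2⟩ := key l hl
      obtain ⟨W, hW⟩ := not_not.1 (hy y hy1)
      exact ⟨W, fun c hc => hW c (hy2 c hc)⟩
    exact ⟨W, (isHenkin_iff W).2 fun p c hc => hW c (.inl ⟨p, hc⟩),
      fun u hu => hW _ (.inr (.inl ⟨u, hu, rfl⟩)), hW _ (.inr (.inr rfl))⟩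
  · rintro ⟨y, hy1, hy2⟩ ⟨W, hW1, hW2, hW3⟩
    refine hy2 ⟨W, fun c hc => ?_⟩
    simp only [proofClauses, List.mem_cons, List.mem_append, List.mem_flatMap, List.mem_map] at hc
    rcases hc with rfl | ⟨p, -, hp⟩ | ⟨u, hu, rfl⟩
    exacts [hW3, (isHenkin_iff W).1 hW1 p c hp, hW2 u (hy1 u hu)]

theorem holds_axClause (W : Atom → Prop) (φ : LA.Sentence) :
    Holds W (axClause (godel φ)) ↔ W (trA (fcode φ) []) := by
  simp [Holds, axClause, godel_eq, -Prod.exists]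

/-- `θ(x̄)` or its negation, where `x` is the Gödel number of `θ`. -/
def DiagSat (b : Bool) (θ : LA.BoundedFormula Empty 1) (M : Type) [LA.Structure M] : Prop :=
  Sat θ (fun _ => num M (godel θ)) ↔ b = true

theorem holds_goalClause (W : Atom → Prop) (b : Bool) (θ : LA.BoundedFormula Empty 1) :
    Holds W (goalClause b (godel θ)) ↔
      (W (trA (fcode θ) [numEl (godel θ)]) ↔ b = true) := by
  cases b <;> simp [Holds, goalClause, godel_eq, -Prod.exists, -Prod.forall]

theorem exists_isHenkin_iff (T : LA.Theory) (b : Bool) (θ : LA.BoundedFormula Empty 1) :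
    (∃ W, IsHenkin W ∧ (∀ u ∈ axiomCodes T, Holds W (axClause u)) ∧
      Holds W (goalClause b (godel θ))) ↔
    ∃ (M : Type) (_ : LA.Structure M), Nonempty M ∧ M ⊨ T ∧ DiagSat b θ M := by
  constructor
  · rintro ⟨W, h, hT, hg⟩
    refine ⟨h.Model, inferInstance, ⟨h.elem 0⟩, ⟨fun φ hφ => ?_⟩, ?_⟩
    · have := hT _ ⟨φ, hφ, rfl⟩
      rw [holds_axClause, (h.tr_iff φ).2 [] rfl] at this
      exact (sat_sentence φ _).2 this
    · rw [holds_goalClause, (h.tr_iff θ).2 _ rfl] at hg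
      rw [DiagSat, ← hg, h.num_eq]
      refine iff_of_eq (congrArg _ (funext fun i => ?_))
      obtain rfl := Subsingleton.elim i 0
      rfl
  · rintro ⟨M, _, _, hT, hg⟩
    refine ⟨modelVal M, isHenkin_modelVal M, ?_, ?_⟩
    · rintro _ ⟨φ, hφ, rfl⟩
      rw [holds_axClause, modelVal_trA_fcode M φ _ rfl, ← sat_sentence]
      exact hT.realize_of_mem φ hφ
    · rw [holds_goalClause, modelVal_trA_fcode M θ _ rfl]
      rw [DiagSat] at hg
      rw [← hg]
      refine iff_of_eq (congrArg _ (funext fun i => ?_))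
      obtain rfl := Subsingleton.elim i 0
      exact interp_numEl M _

theorem forall_models_iff (T : LA.Theory) (b : Bool) (θ : LA.BoundedFormula Empty 1) :
    (∀ (M : Type) [LA.Structure M], Nonempty M → M ⊨ T → ¬ DiagSat b θ M) ↔
      ∃ y : List Param × List ℕ, (∀ u ∈ y.2, u ∈ axiomCodes T) ∧
        Unsat (goalClause b (godel θ) :: proofClauses y) := by
  rw [← not_exists_isHenkin_iff, exists_isHenkin_iff]
  grind

end Refutation

section PrimitiveRecursion

open Encodable

variable {α : Type} [Primcodable α] {u u' v v' : α → List ℕ} {a b c d : α → ℕ}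

theorem primrec_cons {β : Type} [Primcodable β] {f : α → β} {g : α → List β} (hf : Primrec f)
    (hg : Primrec g) : Primrec fun x => f x :: g x :=
  Primrec.list_cons.comp hf hg

theorem primrec_append {β : Type} [Primcodable β] {f g : α → List β} (hf : Primrec f)
    (hg : Primrec g) : Primrec fun x => f x ++ g x :=
  Primrec.list_append.comp hf hg

theorem primrec_el (i : ℕ) (hu : Primrec u) (hv : Primrec v) : Primrec fun x => el i (u x) (v x) :=
  Primrec.encode.comp (.pair (.const i) (.pair hu hv))

theorem primrec_length (hv : Primrec v) : Primrec fun x => (v x).length :=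
  Primrec.list_length.comp hv

theorem primrec_mul_add (i j : ℕ) (ha : Primrec a) : Primrec fun x => i * a x + j :=
  Primrec.nat_add.comp (Primrec.nat_mul.comp (.const i) ha) (.const j)

theorem primrec_add_const (i : ℕ) (ha : Primrec a) : Primrec fun x => a x + i :=
  Primrec.nat_add.comp ha (.const i)

theorem primrec_termToken (ha : Primrec a) (hu : Primrec u) :
    Primrec fun x => termToken (a x) (u x) :=
  Primrec.nat_mul.comp (.const 2) (Primrec₂.natPair.comp ha (Primrec.encode.comp hu))

theorem primrec_valClauses (hu : Primrec u) (hu' : Primrec u') (hv : Primrec v) (hv' : Primrec v')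
    (ha : Primrec a) (hb : Primrec b) :
    Primrec fun x => valClauses (u x) (u' x) (v x) (v' x) (a x) (b x) := by
  unfold valClauses valA binCode succEl addEl mulEl
  repeat' first
    | exact Primrec.const _ | assumption | apply primrec_length | apply primrec_mul_add
    | apply primrec_el | apply primrec_append | apply primrec_cons | apply Primrec.pair

theorem primrec_fmClauses (hu : Primrec u) (hu' : Primrec u') (hv : Primrec v)
    (ha : Primrec a) (hb : Primrec b) :
    Primrec fun x => fmClauses (u x) (u' x) (v x) (a x) (b x) := by
  unfold fmClauses valA fmA binCode falsumCode eqCode leCode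
  repeat' first
    | exact Primrec.const _ | assumption | apply primrec_length | apply primrec_mul_add
    | apply primrec_termToken | apply primrec_add_const
    | apply primrec_append | apply primrec_cons | apply Primrec.pair

theorem primrec_trAtomClauses (hu : Primrec u) (hu' : Primrec u') (hv : Primrec v)
    (ha : Primrec a) (hb : Primrec b) :
    Primrec fun x => trAtomClauses (u x) (u' x) (v x) (a x) (b x) := by
  unfold trAtomClauses valA trA eqA leA falsumCode eqCode leCode
  repeat' first
    | exact Primrec.const _ | assumption | apply primrec_length | apply primrec_mul_add
    | apply primrec_termToken | apply primrec_add_const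
    | apply primrec_append | apply primrec_cons | apply Primrec.pair

theorem primrec_trClauses (hu : Primrec u) (hu' : Primrec u') (hv : Primrec v)
    (ha : Primrec a) : Primrec fun x => trClauses (u x) (u' x) (v x) (a x) := by
  unfold trClauses fmA trA binCode witEl
  repeat' first
    | exact Primrec.const _ | assumption | apply primrec_length | apply primrec_el
    | apply primrec_add_const | apply primrec_append | apply primrec_cons | apply Primrec.pair

theorem primrec_eqClauses (ha : Primrec a) (hb : Primrec b) (hc : Primrec c) (hd : Primrec d) :
    Primrec fun x => eqClauses (a x) (b x) (c x) (d x) := by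
  unfold eqClauses eqA leA succEl addEl mulEl
  repeat' first
    | exact Primrec.const _ | assumption | apply primrec_el | apply primrec_cons
    | apply Primrec.pair

theorem primrec_henkinClauses : Primrec henkinClauses := by
  have h1 : Primrec fun p : Param => p.1.1 := Primrec.fst.comp .fst
  have h2 : Primrec fun p : Param => p.1.2 := Primrec.snd.comp .fst
  have h3 : Primrec fun p : Param => p.2.1.1 := Primrec.fst.comp (Primrec.fst.comp .snd)
  have h4 : Primrec fun p : Param => p.2.1.2 := Primrec.snd.comp (Primrec.fst.comp .snd)
  have h : Primrec fun p : Param => p.2.2 := Primrec.snd.comp .snd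
  have h5 : Primrec fun p : Param => p.2.2.1.1 := Primrec.fst.comp (Primrec.fst.comp h)
  have h6 : Primrec fun p : Param => p.2.2.1.2 := Primrec.snd.comp (Primrec.fst.comp h)
  have h7 : Primrec fun p : Param => p.2.2.2.1 := Primrec.fst.comp (Primrec.snd.comp h)
  have h8 : Primrec fun p : Param => p.2.2.2.2 := Primrec.snd.comp (Primrec.snd.comp h)
  exact primrec_append (primrec_valClauses h1 h2 h3 h4 h5 h6)
    (primrec_append (primrec_fmClauses h1 h2 h3 h5 h6)
    (primrec_append (primrec_trAtomClauses h1 h2 h3 h5 h6)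
    (primrec_append (primrec_trClauses h1 h2 h3 h5) (primrec_eqClauses h5 h6 h7 h8))))

theorem primrec_numEl : Primrec numEl := by
  refine (Primrec.nat_rec₁ zeroEl (f := fun _ a => succEl a) ?_).of_eq fun n => ?_
  · exact primrec_el 1 (.const []) (primrec_cons .snd (.const []))
  · induction n with
    | zero => rfl
    | succ n ih => rw [numEl, ← ih]

theorem primrec_trA {u v : α → List ℕ} (hu : Primrec u) (hv : Primrec v) :
    Primrec fun x => trA (u x) (v x) :=
  .pair (.const 2) (.pair hu hv)

theorem primrec_axClause : Primrec axClause :=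
  .pair (.const []) (primrec_cons (primrec_trA (.ofNat _) (.const [])) (.const []))

theorem primrec_goalClause (b : Bool) : Primrec (goalClause b) := by
  have h : Primrec fun x => trA (Denumerable.ofNat (List ℕ) x) [numEl x] :=
    primrec_trA (.ofNat _) (primrec_cons primrec_numEl (.const []))
  cases b
  · exact .pair (primrec_cons h (.const [])) (.const [])
  · exact .pair (.const []) (primrec_cons h (.const []))

theorem primrec_proofClauses : Primrec proofClauses :=
  primrec_append (Primrec.list_flatMap .fst (primrec_henkinClauses.comp .snd).to₂)
    (Primrec.list_map .snd (primrec_axClause.comp .snd).to₂)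

theorem primrec_subs : Primrec subs := by
  have h : Primrec₂ fun (_ : List Atom) (p : Atom × List (List Atom)) =>
      p.2 ++ p.2.map (p.1 :: ·) :=
    primrec_append (Primrec.snd.comp .snd) (Primrec.list_map (Primrec.snd.comp .snd)
      (primrec_cons (Primrec.fst.comp (Primrec.snd.comp .fst)) .snd).to₂)
  exact Primrec.list_foldr .id (.const _) h

theorem primrec_atoms : Primrec atoms :=
  Primrec.list_flatMap .id
    (primrec_append (Primrec.fst.comp .snd) (Primrec.snd.comp .snd)).to₂

theorem primrecPred_unsat : PrimrecPred Unsat := by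
  have hmem : PrimrecRel fun (p : Atom) (s : List Atom) => p ∈ s := by
    have : PrimrecRel fun (s : List Atom) (p : Atom) => ∃ q ∈ s, q = p :=
      PrimrecRel.exists_mem_list Primrec.eq
    exact (this.comp Primrec.snd Primrec.fst).of_eq fun x => by simp [-Prod.exists]
  have hnmem : PrimrecRel fun (p : Atom) (s : List Atom) => p ∉ s := hmem.not
  have h1 : PrimrecRel fun (c : Clause) (s : List Atom) =>
      (∀ p ∈ c.1, p ∈ s) ∧ ∀ q ∈ c.2, q ∉ s :=
    ((PrimrecRel.forall_mem_list hmem).comp (Primrec.fst.comp .fst) .snd).and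
      ((PrimrecRel.forall_mem_list hnmem).comp (Primrec.snd.comp .fst) .snd)
  have h2 : PrimrecRel fun (s : List Atom) (l : List Clause) =>
      ∃ c ∈ l, (∀ p ∈ c.1, p ∈ s) ∧ ∀ q ∈ c.2, q ∉ s :=
    (PrimrecRel.exists_mem_list h1).comp Primrec.snd Primrec.fst
  exact ((PrimrecRel.forall_mem_list h2).comp (primrec_subs.comp primrec_atoms) .id).of_eq
    fun l => (unsat_iff l).symm

theorem primrecRel_unsat (b : Bool) : PrimrecRel fun x y : ℕ =>
    Unsat (goalClause b x :: proofClauses (Denumerable.ofNat (List Param × List ℕ) y)) :=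
  primrecPred_unsat.comp (primrec_cons ((primrec_goalClause b).comp .fst)
    (primrec_proofClauses.comp ((Primrec.ofNat _).comp .snd)))

theorem primrecRel_not_mem : PrimrecRel fun u y : ℕ =>
    u ∉ (Denumerable.ofNat (List Param × List ℕ) y).2 := by
  have : PrimrecRel fun (s : List ℕ) (p : ℕ) => ∃ q ∈ s, q = p :=
    PrimrecRel.exists_mem_list Primrec.eq
  exact (this.comp (Primrec.snd.comp ((Primrec.ofNat (List Param × List ℕ)).comp .snd))
    Primrec.fst).not.of_eq
    fun x => by simp

theorem le_of_mem_ofNat {u y : ℕ} (h : u ∈ (Denumerable.ofNat (List Param × List ℕ) y).2) :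
    u ≤ y := by
  have h1 := (lt_encode_of_mem h).le.trans
    (Nat.right_le_pair (encode (Denumerable.ofNat (List Param × List ℕ) y).1) _)
  have h2 := Denumerable.encode_ofNat (α := List Param × List ℕ) y
  rw [encode_prod_val] at h2
  exact h1.trans_eq h2

theorem defBy_diag {n : ℕ} {T : LA.Theory} (hT : PiDefinable n (axiomCodes T)) (b : Bool) :
    ∃ R : ℕ → Prop, DefBy (IsSigma (n + 1)) (fun v : Fin 1 → ℕ => R (v 0)) ∧
      ∀ θ : LA.BoundedFormula Empty 1, R (godel θ) ↔
        ∀ (M : Type) [LA.Structure M], Nonempty M → M ⊨ T → ¬ DiagSat b θ M := by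
  obtain ⟨Ψ, hΨ, hdef⟩ := hT
  have hA : DefBy (IsSigma (n + 1)) fun v : Fin 1 → ℕ => v 0 ∈ axiomCodes T := by
    refine ⟨Ψ, .ofPi hΨ, fun v => ?_⟩
    refine Iff.trans ?_ (hdef (v 0)).symm
    refine iff_of_eq (congrArg₂ Ψ.Realize (Subsingleton.elim _ _) (funext fun i => ?_))
    obtain rfl := Subsingleton.elim i 0
    rfl
  refine ⟨fun x => ∃ y, (∀ u ≤ y, u ∉ (Denumerable.ofNat (List Param × List ℕ) y).2 ∨
    u ∈ axiomCodes T) ∧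
    Unsat (goalClause b x :: proofClauses (Denumerable.ofNat (List Param × List ℕ) y)), ?_, ?_⟩
  · refine IsSigma.defBy_exists (IsSigma.defBy_and (IsSigma.defBy_forall_le (.proj 1)
      (IsSigma.defBy_or ?_ ?_)) ?_)
    · exact IsSigma.defBy_subst (g := fun i v => v (![2, 1] i))
        (defBy_of_primrecRel primrecRel_not_mem) fun i => .proj _
    · exact IsSigma.defBy_subst (g := fun _ v => v 2) hA fun i => .proj _
    · exact defBy_of_primrecRel (primrecRel_unsat b)
  · intro θ
    rw [forall_models_iff, (Denumerable.eqv (List Param × List ℕ)).symm.surjective.exists]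
    refine exists_congr fun y => and_congr ⟨fun h u hu => ?_, fun h u _ => ?_⟩ Iff.rfl
    · exact (h u (le_of_mem_ofNat hu)).resolve_left (not_not.2 hu)
    · exact or_iff_not_imp_left.2 fun hu => h u (not_not.1 hu)

theorem exists_isPi_diag {n : ℕ} {T : LA.Theory} (hT : PiDefinable n (axiomCodes T)) (b : Bool) :
    ∃ a : LA.BoundedFormula Empty 2, IsPi n a ∧ ∀ θ : LA.BoundedFormula Empty 1,
      (∃ y : ℕ, Sat a ![godel θ, y]) ↔
        ∀ (M : Type) [LA.Structure M], Nonempty M → M ⊨ T → ¬ DiagSat b θ M := by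
  obtain ⟨R, ⟨φ, hφ, hR⟩, hd⟩ := defBy_diag hT b
  obtain ⟨Q, ⟨a, ha, hQ⟩, -, hQR⟩ := isPiProj_of_isSigma hφ n rfl
  refine ⟨a, ha, fun θ => ?_⟩
  rw [← hd, show R (godel θ) ↔ _ from (hR fun _ => godel θ).symm.trans (hQR _)]
  refine exists_congr fun y => ?_
  rw [hQ]
  refine iff_of_eq (congrArg (Q · y) (funext fun i => ?_))
  obtain rfl := Subsingleton.elim i 0
  rfl

end PrimitiveRecursion

section Rosser

variable {n : ℕ} {a b : LA.BoundedFormula Empty 2}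

theorem exists_rosser (ha : IsPi n a) (hb : IsPi n b) :
    ∃ θ : LA.BoundedFormula Empty 1, IsPi (n + 1) θ ∧
      ∀ (M : Type) [LA.Structure M] (x : M), Sat θ (fun _ => x) ↔
        ∀ y, ¬ Sat b ![x, y] ∨ ∃ z, leM z y ∧ Sat a ![x, z] := by
  obtain ⟨b', hb1, hb2⟩ := isSigma_isPi_hasDual.2 hb
  obtain ⟨a', ha1, ha2⟩ := isSigma_isPi_substClosed.2 ha 3 ![&0, &2]
  refine ⟨_, .all (.sup (.ofSigma hb1) (.bdex (&1) (isSigma_succ_and_isPi_succ.2 ha1))),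
    fun M _ x => ?_⟩
  have h1 (y : M) : (Fin.snoc (fun _ : Fin 1 => x) y : Fin 2 → M) = ![x, y] := by
    funext i
    fin_cases i <;> rfl
  have h2 (y z : M) : (fun i => tval ((![&0, &2] : Fin 2 → LA.Term (Empty ⊕ Fin 3)) i)
      (Fin.snoc ![x, y] z : Fin 3 → M)) = ![x, z] := by
    funext i
    fin_cases i <;> rfl
  rw [Sat, realize_all]
  refine forall_congr' fun y => ?_
  rw [realize_sup, h1]
  refine or_congr (hb2 M _) ((sat_bdex _ _ _).trans ?_)
  simp only [ha2, h2]
  rfl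

theorem IsQ.sat_num_iff {M : Type} [LA.Structure M] (h : IsQ M) (hM : M ⊨ PiTh n) (ha : IsPi n a)
    (p q : ℕ) : Sat a ![num M p, num M q] ↔ Sat a ![p, q] := by
  have hv : (fun i => num M (![p, q] i)) = ![num M p, num M q] := by
    funext i
    fin_cases i <;> rfl
  rw [← hv]
  refine ⟨fun h1 => ?_, h.sat_of_isSigma hM (.ofPi ha) _⟩
  obtain ⟨a', ha1, ha2⟩ := isSigma_isPi_hasDual.2 ha
  by_contra h2
  exact (ha2 _ _).1 (h.sat_of_isSigma hM (isSigma_succ_and_isPi_succ.1 ha1) _ ((ha2 _ _).2 h2)) h1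

theorem proves_iff (T : LA.Theory) (φ : LA.Sentence) :
    Proves T φ ↔ ∀ (M : Type) [LA.Structure M], Nonempty M → M ⊨ T → M ⊨ φ :=
  Theory.models_sentence_iff.trans
    ⟨fun h M _ _ _ => h (.of T M), fun h M => h M inferInstance M.is_model⟩

end Rosser

/-- **Theorem 2.4.** No `Πₙ`-definable extension of `Q` that is consistent with
`Πₙ-Th(ℕ)` is `Π_{n+1}`-deciding: there is a (true) `Π_{n+1}`-sentence `γ`
independent of `T`. -/
theorem piDefinable_consistentWithPiTh_not_piSuccDeciding (n : ℕ) (T : LA.Theory)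
    (hQ : ExtendsQ T) (hdef : PiDefinable n (axiomCodes T))
    (hcon : Consistent (T ∪ PiTh n)) :
    ∃ γ : LA.Sentence, IsPi (n + 1) γ ∧ ℕ ⊨ γ ∧ ¬ Proves T γ ∧ ¬ Proves T (∼γ) := by
  obtain ⟨a, ha, hat⟩ := exists_isPi_diag hdef true
  obtain ⟨b, hb, hbt⟩ := exists_isPi_diag hdef false
  obtain ⟨θ, hθ, hθs⟩ := exists_rosser ha hb
  obtain ⟨γ, hγ, hγs⟩ := isSigma_isPi_substClosed.2 hθ 0 fun _ => numT (godel θ)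
  have hγθ (M : Type) [LA.Structure M] : M ⊨ γ ↔ Sat θ fun _ => num M (godel θ) := by
    rw [sat_sentence γ default, hγs]
    simp only [tval, realize_numT]
  have hA : (∃ y : ℕ, Sat a ![godel θ, y]) ↔ Proves T (∼γ) := by
    simp only [hat, proves_iff, DiagSat, Sentence.realize_not, hγθ, iff_true]
  have hB : (∃ y : ℕ, Sat b ![godel θ, y]) ↔ Proves T γ := by
    simp only [hbt, proves_iff, DiagSat, hγθ, Bool.false_eq_true, iff_false, not_not]
  rw [Consistent, proves_iff] at hcon
  push Not at hcon
  obtain ⟨M, _, _, hM, -⟩ := hcon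
  have hMT : M ⊨ T := hM.mono Set.subset_union_left
  have hMP : M ⊨ PiTh n := hM.mono Set.subset_union_right
  have hMQ : IsQ M := isQ_of_model ⟨fun φ hφ => (proves_iff T φ).1 (hQ φ hφ) M ‹_› hMT⟩
  have hnot : ¬ (Proves T γ ∧ Proves T (∼γ)) := fun ⟨h1, h2⟩ =>
    (Sentence.realize_not M).1 ((proves_iff _ _).1 h2 M ‹_› hMT) ((proves_iff _ _).1 h1 M ‹_› hMT)
  have h1 : ¬ Proves T γ := by
    intro h
    obtain ⟨q, hq⟩ := hB.2 h
    have hθM := (hθs M _).1 ((hγθ M).1 ((proves_iff _ _).1 h M ‹_› hMT)) (num M q)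
    rcases hθM with hn | ⟨z, hz, hza⟩
    · exact hn ((hMQ.sat_num_iff hMP hb _ _).2 hq)
    · obtain ⟨j, -, rfl⟩ := (hMQ.leM_num_iff z q).1 hz
      exact hnot ⟨h, hA.1 ⟨j, (hMQ.sat_num_iff hMP ha _ _).1 hza⟩⟩
  have hb' (q : ℕ) : ¬ Sat b ![godel θ, q] := fun hq => h1 (hB.1 ⟨q, hq⟩)
  refine ⟨γ, hγ, (hγθ ℕ).2 ((hθs ℕ _).2 fun y => .inl ?_), h1, fun h => ?_⟩
  · rw [num_nat]
    exact hb' y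
  · obtain ⟨p, hp⟩ := hA.2 h
    refine (Sentence.realize_not M).1 ((proves_iff _ _).1 h M ‹_› hMT)
      ((hγθ M).2 ((hθs M _).2 fun y => ?_))
    rcases hMQ.leM_num_total y p with hy | hy
    · obtain ⟨j, -, rfl⟩ := (hMQ.leM_num_iff y p).1 hy
      exact .inl fun hj => hb' j ((hMQ.sat_num_iff hMP hb _ _).1 hj)
    · exact .inr ⟨_, hy, (hMQ.sat_num_iff hMP ha _ _).2 hp⟩

end GRNonRE
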